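/- Let σ: 𝒜 → 𝒜⁺ be a (non-erasing) substitution on a finite alphabet 𝒜. Then the set of languages {ℒ_x : x ∈ X_σ} is a finite set. -/

import Mathlib

open scoped BigOperators

namespace Recog

variable {A B C : Type*}

/-- A morphism assigning a word to each letter is non-erasing if every image is nonempty. -/
def NonErasing (σ : A → List B) : Prop := ∀ a, σ a ≠ []

/-- Apply a morphism letterwise to a finite word, concatenating the images. -/
def wordApply (σ : A → List B) : List A → List B
  | [] => []
  | a :: w => σ a ++ wordApply σ w

/-- Composition of morphisms `τ ∘ σ`. -/
def comp (τ : B → List C) (σ : A → List B) : A → List C := fun a => wordApply τ (σ a)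

/-- The `ℓ`-th cutting point of the representation `(0, x)`:
`|σ(x_[0,ℓ))|` for `ℓ ≥ 0` and `-|σ(x_[ℓ,0))|` for `ℓ < 0`. -/
def cut (σ : A → List B) (x : ℤ → A) (ℓ : ℤ) : ℤ :=
  if 0 ≤ ℓ then ∑ i ∈ Finset.range ℓ.toNat, ((σ (x i)).length : ℤ)
  else -∑ i ∈ Finset.range (-ℓ).toNat, ((σ (x (-(i : ℤ) - 1))).length : ℤ)

/-- `y` is the bi-infinite image `σ(x)`, where `σ(x₀)` starts at position `0`. -/
def IsSubstPt (σ : A → List B) (x : ℤ → A) (y : ℤ → B) : Prop :=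
  ∀ (ℓ : ℤ) (j : ℕ) (hj : j < (σ (x ℓ)).length),
    y (cut σ x ℓ + j) = (σ (x ℓ)).get ⟨j, hj⟩

/-- `(k, x)` is a `σ`-representation of `y`, i.e. `y = T^k σ(x)`. -/
def IsRep (σ : A → List B) (y : ℤ → B) (k : ℤ) (x : ℤ → A) : Prop :=
  IsSubstPt σ x fun n => y (n - k)

/-- `(k, x)` is a centered `σ`-representation of `y`: `y = T^k σ(x)` with `0 ≤ k < |σ(x₀)|`. -/
def IsCenteredRep (σ : A → List B) (y : ℤ → B) (k : ℤ) (x : ℤ → A) : Prop :=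
  IsRep σ y k x ∧ 0 ≤ k ∧ k < ((σ (x 0)).length : ℤ)

/-- `y` is aperiodic: `T^p y ≠ y` for all `p ≥ 1`. -/
def Aperiodic (y : ℤ → B) : Prop := ∀ p : ℕ, 1 ≤ p → (fun n => y (n + p)) ≠ y

/-- `y` is periodic: `T^p y = y` for some `p ≥ 1`. -/
def Periodic (y : ℤ → B) : Prop := ∃ p : ℕ, 1 ≤ p ∧ (fun n => y (n + p)) = y

/-- The set of `σ`-cutting points of the representation `(k, x)`. -/
def cutSet (σ : A → List B) (x : ℤ → A) (k : ℤ) : Set ℤ :=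
  {m : ℤ | ∃ ℓ : ℤ, m = cut σ x ℓ - k}

/-- `σ` is recognizable in `X`: every `y` has at most one centered `σ`-representation in `X`. -/
def RecIn (σ : A → List B) (X : Set (ℤ → A)) : Prop :=
  ∀ (y : ℤ → B) (k k' : ℤ) (x x' : ℤ → A), x ∈ X → x' ∈ X →
    IsCenteredRep σ y k x → IsCenteredRep σ y k' x' → k = k' ∧ x = x'

/-- `σ` is recognizable in `X` for aperiodic points. -/
def RecInAp (σ : A → List B) (X : Set (ℤ → A)) : Prop :=
  ∀ y : ℤ → B, Aperiodic y → ∀ (k k' : ℤ) (x x' : ℤ → A), x ∈ X → x' ∈ X →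
    IsCenteredRep σ y k x → IsCenteredRep σ y k' x' → k = k' ∧ x = x'

/-- `σ` is left permutative: the first letters of `σ a` and `σ b` differ for distinct `a, b`. -/
def LeftPermutative (σ : A → List B) : Prop :=
  ∀ a b : A, a ≠ b → (σ a).head? ≠ (σ b).head?

/-- `σ` is right permutative: the last letters of `σ a` and `σ b` differ for distinct `a, b`. -/
def RightPermutative (σ : A → List B) : Prop :=
  ∀ a b : A, a ≠ b → (σ a).getLast? ≠ (σ b).getLast?

/-- `σ` and `σ'` are rotationally conjugate. -/
def RotConj (σ σ' : A → List B) : Prop :=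
  ∃ w : List B, (∀ a, σ a ++ w = w ++ σ' a) ∨ (∀ a, w ++ σ a = σ' a ++ w)

/-- The incidence matrix of `σ`, over `ℚ`: entry `(b, a)` counts occurrences of `b` in `σ a`. -/
noncomputable def incidence (σ : A → List B) [DecidableEq B] : Matrix B A ℚ :=
  Matrix.of fun b a => ((σ a).count b : ℚ)

/-- The finite subword `x_[i, i+m)` of a bi-infinite sequence. -/
def factor (x : ℤ → A) (i : ℤ) (m : ℕ) : List A := (List.range m).map fun j => x (i + j)

/-- The language of a bi-infinite sequence: the set of its finite subwords. -/
def lang (x : ℤ → A) : Set (List A) := {w | ∃ (i : ℤ) (m : ℕ), w = factor x i m}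

/-- `σ` is injective on bi-infinite sequences. -/
def InjZ (σ : A → List B) : Prop :=
  ∀ (x x' : ℤ → A) (y : ℤ → B), IsSubstPt σ x y → IsSubstPt σ x' y → x = x'

/-- Cutting points for one-sided sequences. -/
def cutN (σ : A → List B) (x : ℕ → A) (ℓ : ℕ) : ℕ :=
  ∑ i ∈ Finset.range ℓ, (σ (x i)).length

/-- `y` is the one-sided image `σ(x)` for `x : ℕ → A`. -/
def IsSubstPtN (σ : A → List B) (x : ℕ → A) (y : ℕ → B) : Prop :=
  ∀ (ℓ j : ℕ) (hj : j < (σ (x ℓ)).length),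
    y (cutN σ x ℓ + j) = (σ (x ℓ)).get ⟨j, hj⟩

/-- `σ` is injective on one-sided (right-infinite) sequences. -/
def InjN (σ : A → List B) : Prop :=
  ∀ (x x' : ℕ → A) (y : ℕ → B), IsSubstPtN σ x y → IsSubstPtN σ x' y → x = x'

/-- The total length `⦀σ⦀ = Σ_a |σ a|`. -/
def totalLen (σ : A → List B) [Fintype A] : ℕ := ∑ a, (σ a).length

/-- `X` is invariant under the two-sided shift. -/
def ShiftInvariant (X : Set (ℤ → A)) : Prop :=
  ∀ x ∈ X, (fun n => x (n + 1)) ∈ X ∧ (fun n => x (n - 1)) ∈ X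

/-- The iterate `σ^n` of a substitution, applied to a letter. -/
def iter (σ : A → List A) : ℕ → A → List A
  | 0, a => [a]
  | n + 1, a => wordApply (iter σ n) (σ a)

/-- The language `ℒ_σ` of a substitution: subwords of the `σ^n(a)`. -/
def subLang (σ : A → List A) : Set (List A) := {w | ∃ (n : ℕ) (a : A), w <:+: iter σ n a}

/-- The substitutive shift `X_σ`. -/
def subX (σ : A → List A) : Set (ℤ → A) := {x | ∀ w ∈ lang x, w ∈ subLang σ}

/-- `σ` is recognizable in the sense of Mossé for `x`. -/
def MosseRec (σ : A → List B) (x : ℤ → A) : Prop :=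
  ∃ ℓ : ℕ, ∀ y : ℤ → B, IsSubstPt σ x y →
    ∀ m ∈ cutSet σ x 0, ∀ m' : ℤ,
      factor y (m - ℓ) (2 * ℓ) = factor y (m' - ℓ) (2 * ℓ) → m' ∈ cutSet σ x 0

section Sadic

variable {𝒜 : ℕ → Type*}

/-- `block σ N = σ_[0,N)`, mapping a letter of `𝒜 N` to a word over `𝒜 0`. -/
def block (σ : ∀ n, 𝒜 (n + 1) → List (𝒜 n)) : ∀ N, 𝒜 N → List (𝒜 0)
  | 0, a => [a]
  | N + 1, a => wordApply (block σ N) (σ N a)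

/-- `blockFrom σ n k = σ_[n,n+k)`, mapping a letter of `𝒜 (n+k)` to a word over `𝒜 n`. -/
def blockFrom (σ : ∀ n, 𝒜 (n + 1) → List (𝒜 n)) (n k : ℕ) : 𝒜 (n + k) → List (𝒜 n) :=
  block (𝒜 := fun m => 𝒜 (n + m)) (fun m => σ (n + m)) k

/-- The language `ℒ^(n)_σ` of a directive sequence. -/
def sadicLang (σ : ∀ n, 𝒜 (n + 1) → List (𝒜 n)) (n : ℕ) : Set (List (𝒜 n)) :=
  {w | ∃ (k : ℕ) (a : 𝒜 (n + k)), 1 ≤ k ∧ w <:+: blockFrom σ n k a}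

/-- The shift `X^(n)_σ` of a directive sequence. -/
def sadicX (σ : ∀ n, 𝒜 (n + 1) → List (𝒜 n)) (n : ℕ) : Set (ℤ → 𝒜 n) :=
  {x | ∀ w ∈ lang x, w ∈ sadicLang σ n}

/-- A directive sequence is everywhere growing if `min_a |σ_[0,n)(a)| → ∞`. -/
def EverywhereGrowing (σ : ∀ n, 𝒜 (n + 1) → List (𝒜 n)) : Prop :=
  ∀ m : ℕ, ∃ N : ℕ, ∀ n ≥ N, ∀ a : 𝒜 n, m ≤ (block σ n a).length

end Sadic

end Recog


namespace RecogAux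

open Recog Filter

/-! ### Abstract lemmas -/

lemma uf_lim {α : Type*} (f : ℕ → α) (s : Set α) (hs : s.Finite)
    (h : ∀ᶠ m in (hyperfilter ℕ : Filter ℕ), f m ∈ s) :
    ∃ a ∈ s, ∀ᶠ m in (hyperfilter ℕ : Filter ℕ), f m = a := by
  have h1 : s ∈ (hyperfilter ℕ).map f := h
  obtain ⟨a, ha, hU⟩ := Ultrafilter.eq_pure_of_finite_mem hs h1
  refine ⟨a, ha, ?_⟩
  have : ({a} : Set α) ∈ (hyperfilter ℕ).map f := by
    rw [hU]; exact Set.mem_singleton a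
  exact this

lemma uf_ge (N : ℕ) : ∀ᶠ m in (hyperfilter ℕ : Filter ℕ), N ≤ m :=
  Nat.hyperfilter_le_atTop (eventually_ge_atTop N)

lemma uf_of_large {p : ℕ → Prop} (N : ℕ) (h : ∀ m, N ≤ m → p m) :
    ∀ᶠ m in (hyperfilter ℕ : Filter ℕ), p m :=
  (uf_ge N).mono h

/-- infinite pigeonhole -/
lemma pigeon {α : Type*} (f : ℕ → α) (s : Set α) (hs : s.Finite) (n1 : ℕ)
    (h : ∀ m, n1 ≤ m → f m ∈ s) : ∃ a ∈ s, ∀ N, ∃ m, N ≤ m ∧ f m = a := by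
  obtain ⟨a, ha, h2⟩ := uf_lim f s hs (uf_of_large n1 h)
  refine ⟨a, ha, fun N => ?_⟩
  exact ((uf_ge N).and h2).exists

lemma iter_mono {α : Type*} {Φ : Set α → Set α} (hm : Monotone Φ) (n : ℕ) : Monotone (Φ^[n]) :=
  hm.iterate n

open Classical in
noncomputable def per {α : Type*} (Φ : Set α → Set α) (T : Set α) : ℕ :=
  if h : ∃ p, 1 ≤ p ∧ T ⊆ Φ^[p] T then h.choose else 1

lemma finite_chain {α : Type*} (Φ : Set α → Set α) (hm : Monotone Φ) (TT : Set (Set α))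
    (hT : TT.Finite) :
    {U : Set α | ∃ (L : ℕ → Set α) (n1 : ℕ), (∀ n, n1 ≤ n → L n ∈ TT) ∧
      (∀ n, n1 ≤ n → L n ⊆ Φ (L (n+1))) ∧
      ∀ w, w ∈ U ↔ ∃ n, n1 ≤ n ∧ w ∈ Φ^[n] (L n)}.Finite := by
  classical
  have hfin : (⋃ T ∈ TT, (fun r => {w | ∃ n, n % per Φ T = r ∧ w ∈ Φ^[n] T}) ''
      (Finset.range (per Φ T) : Set ℕ)).Finite := by
    refine hT.biUnion fun T _ => ?_
    exact (Finset.finite_toSet _).image _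
  refine hfin.subset ?_
  rintro U ⟨L, n1, hL, hc, hU⟩
  have hchain : ∀ k n, n1 ≤ n → L n ⊆ Φ^[k] (L (n + k)) := by
    intro k
    induction k with
    | zero => intro n hn; simp
    | succ k ih =>
      intro n hn
      have h1 := ih n hn
      have h2 := hc (n + k) (by omega)
      refine h1.trans ?_
      rw [Function.iterate_succ_apply]
      exact iter_mono hm k h2
  obtain ⟨T, hTT, hf⟩ := pigeon L TT hT n1 hL
  have hper : 1 ≤ per Φ T ∧ T ⊆ Φ^[per Φ T] T := by
    obtain ⟨a, ha, ha'⟩ := hf n1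
    obtain ⟨b, hb, hb'⟩ := hf (a + 1)
    have hex : ∃ p, 1 ≤ p ∧ T ⊆ Φ^[p] T := by
      refine ⟨b - a, by omega, ?_⟩
      have := hchain (b - a) a ha
      rwa [show a + (b - a) = b by omega, ha', hb'] at this
    have he : per Φ T = hex.choose := by unfold per; rw [dif_pos hex]
    rw [he]
    exact hex.choose_spec
  set p := per Φ T with hp
  have hmul : ∀ k, T ⊆ Φ^[k * p] T := by
    intro k
    induction k with
    | zero => simp
    | succ k ih =>
      rw [Nat.succ_mul, Function.iterate_add_apply]
      exact ih.trans (iter_mono hm _ hper.2)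
  choose g hg1 hg2 using hf
  obtain ⟨r, hr, hfr⟩ := pigeon (fun N => g N % p) (Finset.range p : Set ℕ)
    (Finset.finite_toSet _) 0 (fun m _ => by
      simp only [Finset.coe_range, Set.mem_Iio]; exact Nat.mod_lt _ (by omega))
  have hf' : ∀ N, ∃ n, N ≤ n ∧ L n = T ∧ n % p = r := by
    intro N
    obtain ⟨m, hm, h⟩ := hfr N
    exact ⟨g m, hm.trans (hg1 m), hg2 m, h⟩
  simp only [Set.mem_iUnion]
  refine ⟨T, hTT, r, hr, ?_⟩
  symm
  ext w
  rw [hU]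
  constructor
  · rintro ⟨n, hn, hw⟩
    obtain ⟨n', hn', hLn', hr'⟩ := hf' n
    obtain ⟨n'', hn'', hLn'', hr''⟩ := hf' (max n' n1)
    refine ⟨n'', hr'', ?_⟩
    have hnn : n ≤ n'' := by omega
    have := hchain (n'' - n) n hn
    rw [show n + (n'' - n) = n'' by omega, hLn''] at this
    have h3 := iter_mono hm n this hw
    rwa [← Function.iterate_add_apply, show n + (n'' - n) = n'' by omega] at h3
  · rintro ⟨n, hn, hw⟩
    obtain ⟨n', hn', hLn', hr'⟩ := hf' (max n n1)
    refine ⟨n', by omega, ?_⟩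
    rw [hLn']
    have hmod : n ≡ n' [MOD p] := by rw [Nat.ModEq, hn, hr']
    obtain ⟨k, hk⟩ := (Nat.modEq_iff_dvd' (by omega : n ≤ n')).1 hmod
    have h3 := iter_mono hm n (hmul k) hw
    rw [← Function.iterate_add_apply] at h3
    have : n + k * p = n' := by rw [Nat.mul_comm k p]; omega
    rwa [this] at h3

/-! ### Words -/

variable {A : Type*}

/-- The morphism as a map on words. -/
def F (σ : A → List A) (w : List A) : List A := w.flatMap σ

@[simp] lemma F_nil (σ : A → List A) : F σ [] = [] := rfl
@[simp] lemma F_cons (σ : A → List A) (a : A) (w : List A) : F σ (a :: w) = σ a ++ F σ w := by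
  simp [F]
@[simp] lemma F_append (σ : A → List A) (u w : List A) : F σ (u ++ w) = F σ u ++ F σ w := by
  simp [F]
lemma mem_F {σ : A → List A} {w : List A} {c : A} : c ∈ F σ w ↔ ∃ a ∈ w, c ∈ σ a := by
  simp [F]

lemma wordApply_eq (σ : A → List A) (w : List A) : wordApply σ w = F σ w := by
  induction w with
  | nil => rfl
  | cons a w ih => simp [wordApply, ih]

lemma Fit_append (σ : A → List A) (n : ℕ) (u w : List A) :
    (F σ)^[n] (u ++ w) = (F σ)^[n] u ++ (F σ)^[n] w := by
  induction n generalizing u w with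
  | zero => rfl
  | succ n ih => simp [Function.iterate_succ_apply, ih]

lemma Fit_nil (σ : A → List A) (n : ℕ) : (F σ)^[n] [] = [] := by
  induction n with
  | zero => rfl
  | succ n ih => simp [Function.iterate_succ_apply, ih]

lemma Fit_eq (σ : A → List A) (n : ℕ) (w : List A) :
    (F σ)^[n] w = F (fun a => (F σ)^[n] [a]) w := by
  induction w with
  | nil => simp [Fit_nil]
  | cons a w ih =>
    rw [F_cons, ← ih, ← Fit_append]; rfl

lemma iter_eq (σ : A → List A) (n : ℕ) (a : A) : iter σ n a = (F σ)^[n] [a] := by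
  induction n generalizing a with
  | zero => rfl
  | succ n ih =>
    rw [iter, wordApply_eq, Function.iterate_succ_apply, Fit_eq]
    have : iter σ n = fun a => (F σ)^[n] [a] := funext ih
    rw [this]; simp

lemma F_infix (σ : A → List A) {u w : List A} (h : u <:+: w) : F σ u <:+: F σ w := by
  obtain ⟨p, q, rfl⟩ := h
  exact ⟨F σ p, F σ q, by simp⟩

lemma Fit_infix (σ : A → List A) (n : ℕ) {u w : List A} (h : u <:+: w) :
    (F σ)^[n] u <:+: (F σ)^[n] w := by
  obtain ⟨p, q, rfl⟩ := h
  exact ⟨(F σ)^[n] p, (F σ)^[n] q, by simp [Fit_append]⟩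

lemma length_le_F {σ : A → List A} (hσ : ∀ a, σ a ≠ []) (w : List A) :
    w.length ≤ (F σ w).length := by
  induction w with
  | nil => simp
  | cons a w ih =>
    have := List.length_pos_iff.2 (hσ a)
    simp; omega

lemma F_length_le {σ : A → List A} {K : ℕ} (hK : ∀ a, (σ a).length ≤ K) (w : List A) :
    (F σ w).length ≤ K * w.length := by
  induction w with
  | nil => simp
  | cons a w ih =>
    have := hK a
    simp [Nat.mul_add]; omega

/-- splitting lemma -/
lemma F_split {σ : A → List A} {u p r : List A} {g : A} (h : F σ u = p ++ g :: r) :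
    ∃ u1 a u2 s t, u = u1 ++ a :: u2 ∧ σ a = s ++ g :: t ∧ p = F σ u1 ++ s ∧ r = t ++ F σ u2 := by
  induction u generalizing p with
  | nil => simp at h
  | cons a u ih =>
    rw [F_cons, List.append_eq_append_iff] at h
    rcases h with ⟨p', hp, h2⟩ | ⟨s', hs, h2⟩
    · obtain ⟨u1, b, u2, s, t, rfl, h3, rfl, rfl⟩ := ih h2
      exact ⟨a :: u1, b, u2, s, t, rfl, h3, by simp [hp], rfl⟩
    · cases s' with
      | nil =>
        simp at hs h2
        obtain ⟨u1, b, u2, s, t, rfl, h3, h4, rfl⟩ := ih (p := []) h2.symm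
        have h5 : F σ u1 = [] ∧ s = [] := by
          have := h4.symm; simpa using this
        refine ⟨a :: u1, b, u2, s, t, rfl, h3, ?_, rfl⟩
        simp [hs, h5.1, h5.2]
      | cons c s' =>
        simp at h2
        obtain ⟨rfl, rfl⟩ := h2
        exact ⟨[], a, u, p, s', rfl, hs, by simp, rfl⟩

/-! ### factors -/

lemma factor_eq (x : ℤ → A) (i : ℤ) (m : ℕ) :
    factor x i m = (List.range m).map (fun j : ℕ => x (i + (j : ℤ))) := by
  unfold factor
  rw [show (do let a ← List.range m; pure (a : ℤ)) = (List.range m).map (fun j : ℕ => (j : ℤ)) from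
    List.flatMap_pure_eq_map _ _, List.map_map]
  rfl

@[simp] lemma factor_length (x : ℤ → A) (i : ℤ) (m : ℕ) : (factor x i m).length = m := by
  simp [factor_eq]

@[simp] lemma factor_zero (x : ℤ → A) (i : ℤ) : factor x i 0 = [] := rfl

lemma factor_add (x : ℤ → A) (i : ℤ) (m n : ℕ) :
    factor x i (m + n) = factor x i m ++ factor x (i + m) n := by
  simp only [factor_eq, List.range_add, List.map_append, List.map_map]
  congr 1
  apply List.map_congr_left
  intro j _
  simp [add_assoc]

lemma factor_one (x : ℤ → A) (i : ℤ) : factor x i 1 = [x i] := by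
  simp [factor_eq]

lemma factor_succ (x : ℤ → A) (i : ℤ) (n : ℕ) :
    factor x i (n + 1) = x i :: factor x (i + 1) n := by
  rw [add_comm, factor_add, factor_one]; rfl

lemma factor_succ' (x : ℤ → A) (i : ℤ) (n : ℕ) :
    factor x i (n + 1) = factor x i n ++ [x (i + n)] := by
  rw [factor_add, factor_one]

lemma mem_factor {x : ℤ → A} {i : ℤ} {m : ℕ} {c : A} :
    c ∈ factor x i m ↔ ∃ t : ℤ, i ≤ t ∧ t < i + m ∧ x t = c := by
  simp only [factor_eq, List.mem_map, List.mem_range]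
  constructor
  · rintro ⟨j, hj, rfl⟩; exact ⟨i + j, by omega, by omega, rfl⟩
  · rintro ⟨t, h1, h2, rfl⟩
    exact ⟨(t - i).toNat, by omega, by congr 1; omega⟩

lemma factor_infix (x : ℤ → A) {i a : ℤ} {m n : ℕ} (h1 : a ≤ i) (h2 : i + m ≤ a + n) :
    factor x i m <:+: factor x a n := by
  refine ⟨factor x a (i - a).toNat, factor x (i + m) (n - m - (i - a).toNat), ?_⟩
  have e1 : i = a + ((i - a).toNat : ℤ) := by omega
  rw [List.append_assoc, ← factor_add]
  conv_lhs => enter [2, 2]; rw [e1]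
  rw [← factor_add]
  congr 1
  omega

lemma factor_shift (x : ℤ → A) (k i : ℤ) (m : ℕ) :
    factor (fun n => x (n + k)) i m = factor x (i + k) m := by
  simp only [factor_eq]
  apply List.map_congr_left
  intro j _
  congr 1; ring

lemma lang_shift (x : ℤ → A) (k : ℤ) : lang (fun n => x (n + k)) = lang x := by
  ext w
  constructor
  · rintro ⟨i, m, rfl⟩; exact ⟨i + k, m, factor_shift ..⟩
  · rintro ⟨i, m, rfl⟩; exact ⟨i - k, m, by rw [factor_shift]; congr 1; ring⟩

lemma infix_factor {x : ℤ → A} {i : ℤ} {m : ℕ} {w : List A} (h : w <:+: factor x i m) :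
    ∃ j, i ≤ j ∧ j + w.length ≤ i + m ∧ w = factor x j w.length := by
  obtain ⟨p, q, h⟩ := h
  have hl := congrArg List.length h
  simp at hl
  refine ⟨i + p.length, by omega, by omega, ?_⟩
  have : m = p.length + (w.length + q.length) := by omega
  rw [this, factor_add, factor_add, List.append_assoc] at h
  have h1 := List.append_inj h (by simp)
  exact (List.append_inj h1.2 (by simp)).1

lemma lang_infix {x : ℤ → A} {u w : List A} (h : u <:+: w) (hw : w ∈ lang x) : u ∈ lang x := by
  obtain ⟨i, m, rfl⟩ := hw
  obtain ⟨j, -, -, h⟩ := infix_factor h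
  exact ⟨j, _, h⟩

/-- `x` is obtained from `x'` by `Φ`, with cut function `d`. -/
def Rep (Φ : List A → List A) (x x' : ℤ → A) (d : ℤ → ℤ) : Prop :=
  StrictMono d ∧ ∀ (i : ℤ) (m : ℕ), Φ (factor x' i m) = factor x (d i) (d (i + m) - d i).toNat

lemma Rep.comp {Φ Ψ : List A → List A} {x y z : ℤ → A} {d e : ℤ → ℤ} (h1 : Rep Φ x y d)
    (h2 : Rep Ψ y z e) : Rep (Φ ∘ Ψ) x z (d ∘ e) := by
  refine ⟨h1.1.comp h2.1, fun i m => ?_⟩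
  simp only [Function.comp]
  rw [h2.2, h1.2]
  have := h2.1.monotone (show i ≤ i + m by omega)
  congr 4
  omega

lemma Rep_of_step {σ : A → List A} (hσ : ∀ a, σ a ≠ []) {x x' : ℤ → A} {d : ℤ → ℤ}
    (h1 : ∀ i, d (i + 1) = d i + (σ (x' i)).length)
    (h2 : ∀ i, σ (x' i) = factor x (d i) (σ (x' i)).length) : Rep (F σ) x x' d := by
  have hs : StrictMono d := by
    apply strictMono_int_of_lt_succ
    intro i
    have := List.length_pos_iff.2 (hσ (x' i))
    rw [h1]; omega
  refine ⟨hs, fun i m => ?_⟩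
  induction m with
  | zero => simp
  | succ m ih =>
    rw [factor_succ', F_append, ih]
    have h3 := h1 (i + m)
    have hm := hs.monotone (show i ≤ i + m by omega)
    have : (d (i + ((m + 1 : ℕ) : ℤ)) - d i).toNat
        = (d (i + m) - d i).toNat + (σ (x' (i + m))).length := by
      push_cast; rw [← add_assoc, h3]; omega
    rw [this, factor_add]
    congr 1
    simp only [F_cons, F_nil, List.append_nil]
    rw [h2 (i + m), factor_length]
    congr 1
    omega

lemma Rep.single {σ : A → List A} {x x' : ℤ → A} {d : ℤ → ℤ} (h : Rep (F σ) x x' d) (i : ℤ) :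
    σ (x' i) = factor x (d i) (d (i + 1) - d i).toNat := by
  have := h.2 i 1
  rw [factor_one] at this
  simpa using this

/-- index containing a position -/
lemma exists_index {d : ℤ → ℤ} (hd : StrictMono d) (t : ℤ) : ∃ i, d i ≤ t ∧ t < d (i + 1) := by
  have hlow : ∀ n : ℕ, d (-n) ≤ d 0 - n := by
    intro n
    induction n with
    | zero => simp
    | succ n ih =>
      have := hd (show (-((n + 1 : ℕ) : ℤ)) < -(n : ℤ) by omega)
      push_cast at *; omega
  have hup : ∀ n : ℕ, d 0 + n ≤ d n := by
    intro n
    induction n with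
    | zero => simp
    | succ n ih =>
      have := hd (show ((n : ℤ)) < ((n + 1 : ℕ) : ℤ) by omega)
      push_cast at *; omega
  have hb : ∃ b : ℤ, ∀ z : ℤ, d z ≤ t → z ≤ b := by
    refine ⟨(t - d 0).toNat + 1, fun z hz => ?_⟩
    by_contra hc
    push Not at hc
    have := hd hc
    have h2 := hup ((t - d 0).toNat + 1)
    push_cast at h2
    omega
  have he : ∃ z : ℤ, d z ≤ t := ⟨-((d 0 - t).toNat : ℤ), by have := hlow (d 0 - t).toNat; omega⟩
  obtain ⟨i, hi, hmax⟩ := Int.exists_greatest_of_bdd hb he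
  refine ⟨i, hi, ?_⟩
  by_contra hc
  have := hmax (i + 1) (by omega)
  omega

lemma strictMono_gap {d : ℤ → ℤ} (hd : StrictMono d) {i j : ℤ} (h : i ≤ j) : j - i ≤ d j - d i := by
  obtain ⟨n, rfl⟩ := Int.le.dest h
  induction n with
  | zero => simp
  | succ n ih =>
    have h1 := ih (by omega)
    have := hd (show i + (n : ℤ) < i + ((n + 1 : ℕ) : ℤ) by omega)
    push_cast at *; omega

/-! ### Lists with bounded letters -/

lemma first_unique {B : Set A} {t t' s s' : List A} {g g' : A} (hg : g ∉ B) (hg' : g' ∉ B)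
    (ht : ∀ c ∈ t, c ∈ B) (ht' : ∀ c ∈ t', c ∈ B) (h : t ++ g :: s = t' ++ g' :: s') :
    t = t' ∧ g = g' ∧ s = s' := by
  induction t generalizing t' with
  | nil =>
    cases t' with
    | nil => simpa using h
    | cons c t' =>
      simp at h
      exact absurd (ht' c (by simp)) (h.1 ▸ hg)
  | cons c t ih =>
    cases t' with
    | nil =>
      simp at h
      exact absurd (ht c (by simp)) (h.1 ▸ hg')
    | cons c' t' =>
      simp at h
      have := ih (fun c hc => ht c (by simp [hc])) (fun c hc => ht' c (by simp [hc])) h.2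
      simp [h.1, this]

lemma last_unique {B : Set A} {t t' s s' : List A} {g g' : A} (hg : g ∉ B) (hg' : g' ∉ B)
    (ht : ∀ c ∈ t, c ∈ B) (ht' : ∀ c ∈ t', c ∈ B) (h : s ++ g :: t = s' ++ g' :: t') :
    t = t' ∧ g = g' ∧ s = s' := by
  have h2 := congrArg List.reverse h
  simp at h2
  have := first_unique hg hg' (t := t.reverse) (t' := t'.reverse) (by simpa using ht)
    (by simpa using ht') h2
  simpa using this

lemma first_split {B : Set A} {p : List A} (h : ∃ c ∈ p, c ∉ B) :
    ∃ β g q, p = β ++ g :: q ∧ g ∉ B ∧ ∀ c ∈ β, c ∈ B := by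
  classical
  induction p with
  | nil => simp at h
  | cons a p ih =>
    by_cases ha : a ∈ B
    · obtain ⟨c, hc, hcB⟩ := h
      have hc' : c ∈ p := by
        rcases List.mem_cons.1 hc with rfl | h
        · exact absurd ha hcB
        · exact h
      obtain ⟨β, g, q, rfl, hg, hβ⟩ := ih ⟨c, hc', hcB⟩
      exact ⟨a :: β, g, q, rfl, hg, by simpa [ha] using hβ⟩
    · exact ⟨[], a, p, rfl, ha, by simp⟩

lemma last_split {B : Set A} {p : List A} (h : ∃ c ∈ p, c ∉ B) :
    ∃ q g β, p = q ++ g :: β ∧ g ∉ B ∧ ∀ c ∈ β, c ∈ B := by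
  obtain ⟨β, g, q, h1, h2, h3⟩ := first_split (B := B) (p := p.reverse) (by simpa using h)
  refine ⟨q.reverse, g, β.reverse, ?_, h2, by simpa using h3⟩
  have := congrArg List.reverse h1
  simpa using this

/-- powers of words -/
def pw (y : List A) : ℕ → List A
  | 0 => []
  | k + 1 => y ++ pw y k

@[simp] lemma pw_zero (y : List A) : pw y 0 = [] := rfl
lemma pw_succ (y : List A) (k : ℕ) : pw y (k + 1) = y ++ pw y k := rfl
lemma pw_add (y : List A) (j k : ℕ) : pw y (j + k) = pw y j ++ pw y k := by
  induction j with
  | zero => simp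
  | succ j ih => rw [show j + 1 + k = (j + k) + 1 by ring, pw_succ, ih, pw_succ, List.append_assoc]
lemma pw_succ' (y : List A) (k : ℕ) : pw y (k + 1) = pw y k ++ y := by
  rw [pw_add]; simp [pw_succ]
@[simp] lemma pw_nil (k : ℕ) : pw ([] : List A) k = [] := by
  induction k with
  | zero => rfl
  | succ k ih => simp [pw_succ, ih]
@[simp] lemma pw_length (y : List A) (k : ℕ) : (pw y k).length = k * y.length := by
  induction k with
  | zero => simp
  | succ k ih => rw [pw_succ, List.length_append, ih]; ring
lemma pw_reverse (y : List A) (k : ℕ) : (pw y k).reverse = pw y.reverse k := by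
  induction k with
  | zero => rfl
  | succ k ih => rw [pw_succ', List.reverse_append, ih, pw_succ]

/-! ### The normalized setting -/

structure Setting (A : Type*) where
  σ : A → List A
  S : Set (List A)
  B : Set A
  star : A
  finS : S.Finite
  ne : ∀ a, σ a ≠ []
  starB : star ∉ B
  hstar : σ star = [star]
  hB : ∀ b ∈ B, ∀ c ∈ σ b, c ∈ B
  hG : ∀ g, g ∉ B → ∃ c ∈ σ g, c ∉ B
  idem : ∀ b ∈ B, F σ (σ b) = σ b
  hL : ∀ a g s t, σ a = s ++ g :: t → g ∉ B → (∀ c ∈ t, c ∈ B) →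
    ∃ s' t', σ g = s' ++ g :: t' ∧ ∀ c ∈ t', c ∈ B
  hR : ∀ a g s t, σ a = t ++ g :: s → g ∉ B → (∀ c ∈ t, c ∈ B) →
    ∃ s' t', σ g = t' ++ g :: s' ∧ ∀ c ∈ t', c ∈ B
  grow : ∀ K : ℕ, ∃ n0, ∀ n, n0 ≤ n → ∀ g, g ∉ B → g ≠ star → K ≤ ((F σ)^[n] [g]).length

namespace Setting

variable (T : Setting A)

/-- words of the language -/
def Lg : Set (List A) := {w | ∃ n, ∃ s ∈ T.S, w <:+: (F T.σ)^[n] (T.star :: s ++ [T.star])}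

def X : Set (ℤ → A) := {x | (∀ i m, factor x i m ∈ T.Lg) ∧ ∀ i, x i ≠ T.star}

def RelL (a g : A) (t : List A) : Prop := (∃ s, T.σ a = s ++ g :: t) ∧ g ∉ T.B ∧ ∀ c ∈ t, c ∈ T.B
def RelR (a g : A) (t : List A) : Prop := (∃ s, T.σ a = t ++ g :: s) ∧ g ∉ T.B ∧ ∀ c ∈ t, c ∈ T.B

variable {T}

lemma RelL.unique {a g g' : A} {t t' : List A} (h : T.RelL a g t) (h' : T.RelL a g' t') :
    g = g' ∧ t = t' := by
  obtain ⟨⟨s, hs⟩, h1, h2⟩ := h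
  obtain ⟨⟨s', hs'⟩, h1', h2'⟩ := h'
  have := last_unique h1 h1' h2 h2' (hs.symm.trans hs')
  exact ⟨this.2.1, this.1⟩

lemma RelR.unique {a g g' : A} {t t' : List A} (h : T.RelR a g t) (h' : T.RelR a g' t') :
    g = g' ∧ t = t' := by
  obtain ⟨⟨s, hs⟩, h1, h2⟩ := h
  obtain ⟨⟨s', hs'⟩, h1', h2'⟩ := h'
  have := first_unique h1 h1' h2 h2' (hs.symm.trans hs')
  exact ⟨this.2.1, this.1⟩

lemma RelL.fix {a g : A} {t : List A} (h : T.RelL a g t) : ∃ v, T.RelL g g v := by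
  obtain ⟨⟨s, hs⟩, h1, h2⟩ := h
  obtain ⟨s', t', h3, h4⟩ := T.hL a g s t hs h1 h2
  exact ⟨t', ⟨s', h3⟩, h1, h4⟩

lemma RelR.fix {a g : A} {t : List A} (h : T.RelR a g t) : ∃ v, T.RelR g g v := by
  obtain ⟨⟨s, hs⟩, h1, h2⟩ := h
  obtain ⟨s', t', h3, h4⟩ := T.hR a g s t hs h1 h2
  exact ⟨t', ⟨s', h3⟩, h1, h4⟩

lemma RelL.length_le {a g : A} {t : List A} (h : T.RelL a g t) : t.length ≤ (T.σ a).length := by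
  obtain ⟨⟨s, hs⟩, _⟩ := h
  simp [hs]; omega

lemma RelR.length_le {a g : A} {t : List A} (h : T.RelR a g t) : t.length ≤ (T.σ a).length := by
  obtain ⟨⟨s, hs⟩, _⟩ := h
  simp [hs]

lemma F_F {w : List A} (h : ∀ c ∈ w, c ∈ T.B) : F T.σ (F T.σ w) = F T.σ w := by
  induction w with
  | nil => rfl
  | cons a w ih =>
    rw [F_cons, F_append, ih (fun c hc => h c (by simp [hc])), T.idem a (h a (by simp))]

lemma F_pw {y : List A} (h : F T.σ y = y) (k : ℕ) : F T.σ (pw y k) = pw y k := by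
  induction k with
  | zero => rfl
  | succ k ih => rw [pw_succ, F_append, ih, h]

lemma F_B {w : List A} (h : ∀ c ∈ w, c ∈ T.B) : ∀ c ∈ F T.σ w, c ∈ T.B := by
  intro c hc
  obtain ⟨a, ha, hc⟩ := mem_F.1 hc
  exact T.hB a (h a ha) c hc

lemma B_of_F {w : List A} (h : ∀ c ∈ F T.σ w, c ∈ T.B) : ∀ c ∈ w, c ∈ T.B := by
  intro c hc
  by_contra hcB
  obtain ⟨e, he, heB⟩ := T.hG c hcB
  exact heB (h e (mem_F.2 ⟨c, hc, he⟩))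

variable (T) in
def Gap (u : List A) (g : A) (β : List A) (h : A) : Prop :=
  g ∉ T.B ∧ h ∉ T.B ∧ (∀ c ∈ β, c ∈ T.B) ∧ ∃ p q, u = p ++ g :: (β ++ h :: q)

lemma gap_evol {u : List A} {g h : A} {β : List A} (H : T.Gap (F T.σ u) g β h) :
    (∃ a, T.Gap (T.σ a) g β h) ∨ ∃ g' h' β' t t', T.Gap u g' β' h' ∧ T.RelL g' g t ∧
      T.RelR h' h t' ∧ β = t ++ F T.σ β' ++ t' := by
  obtain ⟨hg, hh, hβ, p, q, hu⟩ := H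
  obtain ⟨u1, a, u2, s, t, rfl, ha, -, hr⟩ := F_split hu
  rw [List.append_eq_append_iff] at hr
  have key : ∀ β2, β = t ++ β2 → F T.σ u2 = β2 ++ h :: q → ∃ g' h' β' t t',
      T.Gap (u1 ++ a :: u2) g' β' h' ∧ T.RelL g' g t ∧
      T.RelR h' h t' ∧ β = t ++ F T.σ β' ++ t' := by
    rintro β2 rfl h2
    obtain ⟨u3, h', u4, s', t', rfl, hh', rfl, -⟩ := F_split h2
    refine ⟨a, h', u3, t, s', ⟨?_, ?_, ?_, u1, u4, rfl⟩, ⟨⟨s, ha⟩, hg, ?_⟩,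
      ⟨⟨t', hh'⟩, hh, ?_⟩, by simp⟩
    · intro haB
      exact hg (T.hB a haB g (by simp [ha]))
    · intro haB
      exact hh (T.hB h' haB h (by simp [hh']))
    · apply B_of_F
      intro c hc; exact hβ c (by simp [hc])
    · intro c hc; exact hβ c (by simp [hc])
    · intro c hc; exact hβ c (by simp [hc])
  rcases hr with ⟨t2, h1, h2⟩ | ⟨β2, h1, h2⟩
  · cases t2 with
    | nil =>
      right
      exact key [] (by simpa using h1.symm) (by simpa using h2.symm)
    | cons c t2 =>
      simp at h2
      obtain ⟨rfl, rfl⟩ := h2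
      exact Or.inl ⟨a, hg, hh, hβ, s, t2, by rw [ha, h1]⟩
  · right
    exact key β2 h1 h2

variable (T) in
def Gapped (g : A) (β : List A) (h : A) : Prop :=
  ∃ n, ∃ s ∈ T.S, T.Gap ((F T.σ)^[n] (T.star :: s ++ [T.star])) g β h

lemma Gap.length_lt {u : List A} {g h : A} {β : List A} (H : T.Gap u g β h) :
    β.length ≤ u.length := by
  obtain ⟨_, _, _, p, q, rfl⟩ := H
  simp; omega

variable (T) in
def Form (M : ℕ) (g : A) (β : List A) (h : A) : Prop :=
  ∃ v v' f k, T.RelL g g v ∧ T.RelR h h v' ∧ f.length ≤ M ∧ F T.σ f = f ∧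
      β = v ++ (pw (F T.σ v) k ++ f ++ pw (F T.σ v') k) ++ v'

lemma exists_len [Finite A] (T : Setting A) : ∃ K, ∀ a, (T.σ a).length ≤ K := by
  obtain ⟨K, hK⟩ := (Set.finite_range (fun a => (T.σ a).length)).bddAbove
  exact ⟨K, fun a => hK ⟨a, rfl⟩⟩

lemma exists_lenS (T : Setting A) : ∃ K, ∀ s ∈ T.S, (T.star :: s ++ [T.star]).length ≤ K := by
  obtain ⟨K, hK⟩ := (T.finS.image (fun s => (T.star :: s ++ [T.star]).length)).bddAbove
  exact ⟨K, fun s hs => hK ⟨s, hs, rfl⟩⟩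

lemma gap_thm [Finite A] (T : Setting A) : ∃ M, (∀ a, (T.σ a).length ≤ M) ∧
    (∀ a, (F T.σ (T.σ a)).length ≤ M) ∧
    ∀ g β h, T.Gapped g β h → β.length ≤ M ∨ T.Form M g β h := by
  obtain ⟨K1, hK1⟩ := T.exists_len
  obtain ⟨K2, hK2⟩ := T.exists_lenS
  set K := K1 + K2 with hK
  set M1 := K + K * K + K with hM1
  have hσ : ∀ a, (T.σ a).length ≤ K := fun a => (hK1 a).trans (by omega)
  have main : ∀ n, ∀ s ∈ T.S, ∀ g β h, T.Gap ((F T.σ)^[n] (T.star :: s ++ [T.star])) g β h →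
      β.length ≤ K ∨ (β.length ≤ M1 ∧ ∃ v v', T.RelL g g v ∧ T.RelR h h v') ∨
      T.Form (K * M1) g β h := by
    intro n s hs
    induction n with
    | zero =>
      intro g β h H
      left
      have := H.length_lt
      have h2 := hK2 s hs
      simp only [Function.iterate_zero, id] at this
      omega
    | succ n ih =>
      intro g β h H
      rw [Function.iterate_succ_apply'] at H
      rcases gap_evol H with ⟨a, H⟩ | ⟨g', h', β', t, t', H2, hl, hr, hβ⟩
      · left
        have := H.length_lt
        have := hσ a
        omega
      · right
        obtain ⟨v, hv⟩ := hl.fix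
        obtain ⟨v', hv'⟩ := hr.fix
        have hFl := F_length_le hσ β'
        rcases ih _ _ _ H2 with h1 | ⟨h1, w, w', hw, hw'⟩ | ⟨w, w', f, k, hw, hw', hf, hf2, hb⟩
        · left
          refine ⟨?_, v, v', hv, hv'⟩
          have e1 := hl.length_le.trans (hσ _)
          have e2 := hr.length_le.trans (hσ _)
          have e3 := Nat.mul_le_mul_left K h1
          rw [hβ]; simp; omega
        · right
          obtain ⟨rfl, rfl⟩ := hw.unique hl
          obtain ⟨rfl, rfl⟩ := hw'.unique hr
          exact ⟨w, w', F T.σ β', 0, hw, hw', hFl.trans (Nat.mul_le_mul_left K h1),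
            F_F H2.2.2.1, by simpa using hβ⟩
        · right
          obtain ⟨rfl, rfl⟩ := hw.unique hl
          obtain ⟨rfl, rfl⟩ := hw'.unique hr
          refine ⟨w, w', f, k + 1, hw, hw', hf, hf2, ?_⟩
          rw [hβ, hb]
          simp only [F_append, F_pw (F_F hw.2.2), F_pw (F_F hw'.2.2), hf2]
          rw [pw_succ, pw_succ']
          simp
  refine ⟨K + M1 + K * M1, fun a => (hσ a).trans (by omega), fun a => ?_, ?_⟩
  · have := F_length_le hσ (T.σ a)
    have h2 := Nat.mul_le_mul_left K (hσ a)
    have : K ≤ M1 := by omega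
    have := Nat.mul_le_mul_left K this
    omega
  · rintro g β h ⟨n, s, hs, H⟩
    rcases main n s hs g β h H with h1 | ⟨h1, _⟩ | ⟨v, v', f, k, h1, h2, h3, h4⟩
    · left; omega
    · left; omega
    · exact Or.inr ⟨v, v', f, k, h1, h2, by omega, h4⟩

lemma Lg_infix {u w : List A} (h : u <:+: w) (hw : w ∈ T.Lg) : u ∈ T.Lg := by
  obtain ⟨n, s, hs, h2⟩ := hw
  exact ⟨n, s, hs, h.trans h2⟩

lemma Fit_star (T : Setting A) (n : ℕ) (s : List A) : (F T.σ)^[n] (T.star :: s ++ [T.star]) =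
    T.star :: (F T.σ)^[n] s ++ [T.star] := by
  induction n generalizing s with
  | zero => rfl
  | succ n ih => 
    rw [Function.iterate_succ_apply, Function.iterate_succ_apply, ← ih]
    simp [T.hstar]

lemma star_left {p w q s : List A} (h : p ++ w ++ q = T.star :: s ++ [T.star])
    (hw : ∀ c ∈ w, c ∈ T.B) (hw0 : w ≠ []) : ∃ c ∈ p, c ∉ T.B := by
  cases p with
  | nil =>
    cases w with
    | nil => exact absurd rfl hw0
    | cons c w =>
      simp at h
      exact absurd (hw c (by simp)) (h.1 ▸ T.starB)
  | cons c p =>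
    simp at h
    exact ⟨c, by simp, h.1 ▸ T.starB⟩

lemma star_right {p w q s : List A} (h : p ++ w ++ q = T.star :: s ++ [T.star])
    (hw : ∀ c ∈ w, c ∈ T.B) (hw0 : w ≠ []) : ∃ c ∈ q, c ∉ T.B := by
  have h2 := congrArg List.reverse h
  have := star_left (T := T) (p := q.reverse) (w := w.reverse) (q := p.reverse) (s := s.reverse)
    (by simpa using h2) (by simpa using hw) (by simpa using hw0)
  simpa using this

lemma gap_of_mid {w : List A} (h : w ∈ T.Lg) (hw : ∀ c ∈ w, c ∈ T.B) (hw0 : w ≠ []) :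
    ∃ g h β1 β2, T.Gapped g (β1 ++ w ++ β2) h := by
  obtain ⟨n, s, hs, p, q, h⟩ := h
  have h' := h
  rw [Fit_star] at h'
  obtain ⟨p', g, β1, rfl, hg, hβ1⟩ := last_split (star_left h' hw hw0)
  obtain ⟨β2, e, q', rfl, he, hβ2⟩ := first_split (star_right h' hw hw0)
  refine ⟨g, e, β1, β2, n, s, hs, hg, he, ?_, p', q', ?_⟩
  · intro c hc
    simp only [List.mem_append] at hc
    rcases hc with (hc | hc) | hc
    exacts [hβ1 c hc, hw c hc, hβ2 c hc]
  · rw [← h]; simp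

lemma gap_of_left {β : List A} {e : A} (h : β ++ [e] ∈ T.Lg) (hw : ∀ c ∈ β, c ∈ T.B)
    (hw0 : β ≠ []) (he : e ∉ T.B) : ∃ g β1, T.Gapped g (β1 ++ β) e := by
  obtain ⟨n, s, hs, p, q, h⟩ := h
  have h' := h
  rw [Fit_star] at h'
  obtain ⟨p', g, β1, rfl, hg, hβ1⟩ := last_split (star_left (w := β) (q := e :: q)
    (by simpa using h') hw hw0)
  refine ⟨g, β1, n, s, hs, hg, he, ?_, p', q, ?_⟩
  · intro c hc
    simp only [List.mem_append] at hc
    rcases hc with hc | hc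
    exacts [hβ1 c hc, hw c hc]
  · rw [← h]; simp

lemma gap_of_both {β : List A} {g e : A} (h : g :: (β ++ [e]) ∈ T.Lg) (hw : ∀ c ∈ β, c ∈ T.B)
    (hg : g ∉ T.B) (he : e ∉ T.B) : T.Gapped g β e := by
  obtain ⟨n, s, hs, p, q, h⟩ := h
  exact ⟨n, s, hs, hg, he, hw, p, q, by rw [← h]; simp⟩

/-! ### Desubstitution -/

lemma take_step {σ : A → List A} {w : List A} {k : ℕ} (hk : k < w.length) :
    (F σ (w.take (k + 1))).length = (F σ (w.take k)).length + (σ w[k]).length := by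
  rw [← List.take_concat_get' _ _ hk, F_append, List.length_append]
  simp

lemma take_lip {σ : A → List A} {K : ℕ} (hK : ∀ a, (σ a).length ≤ K) (w : List A) (k j : ℕ) :
    (F σ (w.take k)).length ≤ (F σ (w.take (k + j))).length ∧
    (F σ (w.take (k + j))).length ≤ (F σ (w.take k)).length + K * j := by
  rw [List.take_add, F_append, List.length_append]
  have := F_length_le hK ((w.drop k).take j)
  have h2 : ((w.drop k).take j).length ≤ j := by simp
  have := Nat.mul_le_mul_left K h2
  omega

lemma infix_get {x : ℤ → A} {i : ℤ} {m : ℕ} {u w p q : List A} (h : p ++ factor x i m ++ q = w)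
    {P : List A} {Q : List A} (hw : w = P ++ u ++ Q) (h1 : p.length ≤ P.length)
    (h2 : P.length + u.length ≤ p.length + m) :
    u = factor x (i + P.length - p.length) u.length := by
  have e : m = (P.length - p.length) + (u.length + (p.length + m - P.length - u.length)) := by
    omega
  rw [e, factor_add, factor_add, hw] at h
  have h3 : (p ++ factor x i (P.length - p.length)) ++
      (factor x (i + ((P.length - p.length : ℕ) : ℤ)) u.length ++
      (factor x (i + ((P.length - p.length : ℕ) : ℤ) + (u.length : ℤ))
        (p.length + m - P.length - u.length) ++ q)) = P ++ (u ++ Q) := by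
    simpa using h
  have h4 := List.append_inj h3 (by simp; omega)
  have h5 := List.append_inj h4.2 (by simp)
  rw [← h5.1, factor_length]
  congr 1
  omega

lemma approx [Finite A] {x : ℤ → A} (hx : x ∈ T.X) {K : ℕ} (hK : ∀ a, (T.σ a).length ≤ K) (m : ℕ) :
    ∃ (x' : ℤ → A) (d : ℤ → ℤ), d 0 ≤ 0 ∧ 0 < d 1 ∧
      (∀ i : ℤ, |d i| ≤ K * (|i| + 1)) ∧
      (∀ r : ℕ, K * (r + 2) ≤ m → ∀ i : ℤ, |i| ≤ (r : ℤ) → d (i + 1) = d i + (T.σ (x' i)).length ∧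
        T.σ (x' i) = factor x (d i) (T.σ (x' i)).length) ∧
      (∀ r : ℕ, K * (r + 2) ≤ m → factor x' (-r) (2 * r + 1) ∈ T.Lg) := by
  obtain ⟨K2, hK2⟩ := T.exists_lenS
  obtain ⟨n, s, hs, p, q, h⟩ := hx.1 (-((m + K2 : ℕ) : ℤ)) (2 * (m + K2) + 1)
  have hn : n ≠ 0 := by
    rintro rfl
    have h1 := congrArg List.length h
    have h2 := hK2 s hs
    simp only [Function.iterate_zero, id, List.length_append, factor_length] at h1 h2
    omega
  obtain ⟨n, rfl⟩ := Nat.exists_eq_succ_of_ne_zero hn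
  rw [Function.iterate_succ_apply'] at h
  set w := (F T.σ)^[n] (T.star :: s ++ [T.star]) with hw
  set m' := m + K2 with hm'
  have h0 : F T.σ w = (p ++ factor x (-(m' : ℤ)) m') ++ x 0 :: (factor x 1 m' ++ q) := by
    rw [← h, show 2 * m' + 1 = m' + (m' + 1) by ring, factor_add, factor_succ]
    simp
  obtain ⟨w1, a, w2, u, t, hw12, ha, hp, hq⟩ := F_split h0
  have hlenp := congrArg List.length hp
  have hlenq := congrArg List.length hq
  simp only [List.length_append, factor_length] at hlenp hlenq
  have haK := hK a
  have hal : (T.σ a).length = u.length + 1 + t.length := by simp [ha]; ring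
  have hw1K := F_length_le hK w1
  have hw2K := F_length_le hK w2
  set N := w1.length with hN
  have hwl : w.length = N + 1 + w2.length := by rw [hw12]; simp; ring
  have htake : w.take N = w1 := by rw [hw12, hN]; simp
  have hwN : ∀ (hh : N < w.length), w[N] = a := by
    intro hh
    simp [hw12, hN]
  -- definitions
  refine ⟨fun i => w.getD (N + i).toNat a,
    fun i => ((F T.σ (w.take (N + i).toNat)).length : ℤ) - (F T.σ w1).length - u.length,
    ?_, ?_, ?_, ?_, ?_⟩
  · simp [htake]
  · have := take_step (σ := T.σ) (w := w) (k := N) (by omega)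
    rw [hwN, htake] at this
    have e : ((N : ℤ) + 1).toNat = N + 1 := by omega
    simp only [e, this]
    omega
  · intro i
    have hu : (u.length : ℤ) ≤ K := by omega
    have hKi : (K : ℤ) * (|i| + 1) = K * |i| + K := by ring
    have hK0 : (0 : ℤ) ≤ K := by omega
    rw [hKi]
    simp only
    rcases le_total 0 i with hi | hi
    · obtain ⟨j, rfl⟩ := Int.eq_ofNat_of_zero_le hi
      have := take_lip hK w N j
      rw [htake] at this
      have e : ((N : ℤ) + j).toNat = N + j := by omega
      rw [e, abs_of_nonneg (by omega : (0 : ℤ) ≤ (j : ℤ)), abs_le]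
      zify at this
      constructor <;> nlinarith
    · obtain ⟨j, hj⟩ := Int.eq_ofNat_of_zero_le (by omega : 0 ≤ -i)
      obtain rfl : i = -(j : ℤ) := by omega
      have := take_lip hK w ((N : ℤ) + -(j : ℤ)).toNat (N - ((N : ℤ) + -(j : ℤ)).toNat)
      rw [show ((N : ℤ) + -(j : ℤ)).toNat + (N - ((N : ℤ) + -(j : ℤ)).toNat) = N by omega,
        htake] at this
      have h3 : (N - ((N : ℤ) + -(j : ℤ)).toNat) ≤ j := by omega
      have h4 := Nat.mul_le_mul_left K h3
      have h5 : (F T.σ w1).length ≤ (F T.σ (w.take ((N : ℤ) + -(j : ℤ)).toNat)).length + K * j := by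
        omega
      rw [abs_neg, abs_of_nonneg (by omega : (0 : ℤ) ≤ (j : ℤ)), abs_le]
      have h6 := this.1
      zify at h5 h6
      constructor <;> linarith
  · intro r hr i hi
    have hrN : r + 1 ≤ N := by
      by_contra hc
      have : N ≤ r := by omega
      have := Nat.mul_le_mul_left K this
      have e : K * (r + 2) = K * r + K * 2 := by ring
      omega
    have hrN2 : r + 1 ≤ w2.length := by
      by_contra hc
      have : w2.length ≤ r := by omega
      have := Nat.mul_le_mul_left K this
      have e : K * (r + 2) = K * r + K * 2 := by ring
      omega
    rw [abs_le] at hi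
    obtain ⟨k, hk⟩ := Int.eq_ofNat_of_zero_le (by omega : 0 ≤ (N : ℤ) + i)
    obtain rfl : i = (k : ℤ) - N := by omega
    have e1 : ((N : ℤ) + ((k : ℤ) - N)).toNat = k := by omega
    have e2 : ((N : ℤ) + ((k : ℤ) - N + 1)).toNat = k + 1 := by omega
    have hkw : k < w.length := by omega
    have hst := take_step (σ := T.σ) hkw
    simp only [e1, e2]
    have hget : w.getD k a = w[k] := List.getD_eq_getElem _ _ hkw
    rw [hget]
    refine ⟨by omega, ?_⟩
    have hsplit : w = w.take k ++ [w[k]] ++ w.drop (k + 1) := by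
      rw [List.take_concat_get' _ _ hkw, List.take_append_drop]
    have hFw : F T.σ w = F T.σ (w.take k) ++ T.σ w[k] ++ F T.σ (w.drop (k + 1)) := by
      have h7 := congrArg (F T.σ) hsplit
      simpa only [F_append, F_cons, F_nil, List.append_nil] using h7
    -- bounds
    have hl1 : (F T.σ w1).length ≤ (F T.σ (w.take k)).length + K * r ∧
        (F T.σ (w.take k)).length ≤ (F T.σ w1).length + K * r := by
      rcases le_total k N with hkN | hkN
      · have := take_lip hK w k (N - k)
        rw [show k + (N - k) = N by omega, htake] at this
        have h4 := Nat.mul_le_mul_left K (show N - k ≤ r by omega)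
        omega
      · have := take_lip hK w N (k - N)
        rw [show N + (k - N) = k by omega, htake] at this
        have h4 := Nat.mul_le_mul_left K (show k - N ≤ r by omega)
        omega
    have hKr : K * (r + 2) = K * r + K * 2 := by ring
    have hKk := hK w[k]
    have := infix_get h hFw (by omega) (by omega)
    rw [this, factor_length]
    congr 1
    omega
  · intro r hr
    have hrN : r + 1 ≤ N := by
      by_contra hc
      have : N ≤ r := by omega
      have := Nat.mul_le_mul_left K this
      have e : K * (r + 2) = K * r + K * 2 := by ring
      omega
    have hrN2 : r + 1 ≤ w2.length := by
      by_contra hc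
      have : w2.length ≤ r := by omega
      have := Nat.mul_le_mul_left K this
      have e : K * (r + 2) = K * r + K * 2 := by ring
      omega
    refine ⟨n, s, hs, ?_⟩
    rw [← hw]
    have : factor (fun i : ℤ => w.getD (N + i).toNat a) (-r) (2 * r + 1) =
        (w.drop (N - r)).take (2 * r + 1) := by
      apply List.ext_getElem
      · simp; omega
      · intro j h1 h2
        simp only [factor_length] at h1
        simp only [factor_eq, List.getElem_map, List.getElem_range, List.getElem_take,
          List.getElem_drop]
        have e : ((N : ℤ) + (-(r : ℤ) + (j : ℤ))).toNat = N - r + j := by omega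
        rw [e, List.getD_eq_getElem _ _ (by omega)]
    rw [this]
    exact (List.take_prefix _ _).isInfix.trans (List.drop_suffix _ _).isInfix

lemma desub [Finite A] {x : ℤ → A} (hx : x ∈ T.X) :
    ∃ x' ∈ T.X, ∃ d, Rep (F T.σ) x x' d ∧ d 0 ≤ 0 ∧ 0 < d 1 := by
  obtain ⟨K, hK⟩ := T.exists_len
  choose y e h0 h1 hb hstep hLg using approx hx hK
  have hylim : ∀ i, ∃ a, ∀ᶠ m in (hyperfilter ℕ : Filter ℕ), y m i = a := by
    intro i
    obtain ⟨a, -, h⟩ := uf_lim (fun m => y m i) Set.univ Set.finite_univ (by simp)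
    exact ⟨a, h⟩
  have helim : ∀ i, ∃ a, ∀ᶠ m in (hyperfilter ℕ : Filter ℕ), e m i = a := by
    intro i
    obtain ⟨a, -, h⟩ := uf_lim (fun m => e m i) (Set.Icc (-(K * (|i| + 1))) (K * (|i| + 1)))
      (Set.finite_Icc _ _) (Filter.Eventually.of_forall fun m => abs_le.1 (hb m i))
    exact ⟨a, h⟩
  choose x' hx' using hylim
  choose d hd using helim
  have hst : ∀ i, d (i + 1) = d i + (T.σ (x' i)).length ∧
        T.σ (x' i) = factor x (d i) (T.σ (x' i)).length := by
    intro i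
    obtain ⟨m, h1, h2, h3, h4⟩ := ((uf_ge (K * (i.natAbs + 2))).and
      ((hx' i).and ((hd i).and (hd (i + 1))))).exists
    have := hstep m i.natAbs h1 i (Int.natCast_natAbs i).ge
    rwa [h2, h3, h4] at this
  have hrep := Rep_of_step T.ne (fun i => (hst i).1) (fun i => (hst i).2)
  refine ⟨x', ⟨?_, ?_⟩, d, hrep, ?_, ?_⟩
  · intro i n
    set r := i.natAbs + n with hr
    have hall : ∀ᶠ m in (hyperfilter ℕ : Filter ℕ), ∀ j ∈ Finset.Icc (-(r : ℤ)) (r + 1), y m j = x' j := by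
      rw [Filter.eventually_all_finset]
      intro j _; exact hx' j
    obtain ⟨m, h1, h2⟩ := ((uf_ge (K * (r + 2))).and hall).exists
    have h3 := hLg m r h1
    have h4 : factor (y m) (-r) (2 * r + 1) = factor x' (-r) (2 * r + 1) := by
      rw [factor_eq, factor_eq]
      apply List.map_congr_left
      intro j hj
      rw [List.mem_range] at hj
      apply h2
      rw [Finset.mem_Icc]
      constructor <;> omega
    rw [h4] at h3
    refine Lg_infix (factor_infix x' ?_ ?_) h3 <;> push_cast <;> omega
  · intro i hi
    have := hrep.single i
    rw [hi, T.hstar] at this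
    have h2 : T.star ∈ factor x (d i) (d (i + 1) - d i).toNat := by rw [← this]; simp
    obtain ⟨t, -, -, ht⟩ := mem_factor.1 h2
    exact hx.2 t ht
  · obtain ⟨m, h⟩ := (hd 0).exists
    rw [← h]; exact h0 m
  · obtain ⟨m, h⟩ := (hd 1).exists
    rw [← h]; exact h1 m

/-! ### Case 1: all letters bounded -/

lemma cover {p W q p2 V q2 : List A} (h : p ++ W ++ q = p2 ++ V ++ q2) (h1 : p.length ≤ p2.length)
    (h2 : q.length ≤ q2.length) : V <:+: W := by
  have hl := congrArg List.length h
  simp only [List.length_append] at hl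
  have e1 : p <+: p2 := by
    refine List.prefix_of_prefix_length_le (l₃ := p ++ W ++ q) ⟨W ++ q, by simp⟩ ?_ h1
    exact ⟨V ++ q2, by rw [h]; simp⟩
  have e2 : q <:+ q2 := by
    refine List.suffix_of_suffix_length_le (l₃ := p ++ W ++ q) ⟨p ++ W, by simp⟩ ?_ h2
    exact ⟨p2 ++ V, by rw [h]⟩
  obtain ⟨a, rfl⟩ := e1
  obtain ⟨b, rfl⟩ := e2
  have h3 : p ++ (W ++ q) = p ++ ((a ++ V ++ b) ++ q) := by simpa using h
  have h4 := List.append_cancel_right (List.append_cancel_left h3)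
  exact ⟨a, b, h4.symm⟩

def Sub1 (y f z : List A) : Set (List A) := {w | ∃ k, w <:+: pw y k ++ f ++ pw z k}

lemma pw_infix {y u : List A} {K k : ℕ} (h : u <:+: pw y K) (hl : (k + 1) * y.length ≤ u.length) :
    pw y k <:+: u := by
  by_cases hy : y = []
  · subst hy; simp
  have hy0 := List.length_pos_iff.2 hy
  obtain ⟨p, q, h⟩ := h
  have hlen := congrArg List.length h
  simp only [List.length_append, pw_length] at hlen
  set L := y.length with hL
  set j := p.length / L + 1 with hj
  have h1 : p.length < j * L := by
    have := Nat.lt_div_mul_add (a := p.length) hy0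
    rw [hj, Nat.add_mul]; omega
  have h2 : j * L ≤ p.length + L := by
    have := Nat.div_mul_le_self p.length L
    rw [hj, Nat.add_mul]; omega
  have h3 : (j + k) * L ≤ K * L := by
    have e : (j + k) * L = j * L + k * L := by ring
    have e' : (k + 1) * L = k * L + L := by ring
    omega
  have h4 := Nat.le_of_mul_le_mul_right h3 hy0
  obtain ⟨r, rfl⟩ := Nat.exists_eq_add_of_le h4
  rw [pw_add, pw_add] at h
  refine cover h (by rw [pw_length, ← hL]; exact h1.le) ?_
  have e : (j + k + r) * L = j * L + k * L + r * L := by ring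
  have e' : (k + 1) * L = k * L + L := by ring
  simp only [pw_length, ← hL]
  omega

lemma pw_suffix_infix (y : List A) {k : ℕ} : pw y k <:+: pw y k ++ [] ++ pw [] k := by simp

lemma lang_eq_pw_left {x : ℤ → A} {y : List A} (h : lang x ⊆ Sub1 y [] []) :
    lang x = Sub1 y [] [] := by
  apply h.antisymm
  rintro w ⟨k, hw⟩
  simp only [pw_nil, List.append_nil] at hw
  refine lang_infix hw ?_
  obtain ⟨K, hK⟩ := h ⟨0, (k + 1) * y.length, rfl⟩
  simp only [pw_nil, List.append_nil] at hK
  exact lang_infix (pw_infix hK (by simp)) ⟨0, _, rfl⟩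

lemma lang_eq_pw_right {x : ℤ → A} {y : List A} (h : lang x ⊆ Sub1 [] [] y) :
    lang x = Sub1 [] [] y := by
  have e : (Sub1 [] [] y : Set (List A)) = Sub1 y [] [] := by simp [Sub1]
  rw [e] at h ⊢
  exact lang_eq_pw_left h

lemma lang_trichotomy {x : ℤ → A} {y f z : List A} (h : lang x ⊆ Sub1 y f z) :
    lang x = Sub1 y [] [] ∨ lang x = Sub1 [] [] z ∨ lang x = Sub1 y f z := by
  by_cases h1 : lang x ⊆ Sub1 y [] []
  · exact Or.inl (lang_eq_pw_left h1)
  by_cases h2 : lang x ⊆ Sub1 [] [] z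
  · exact Or.inr (Or.inl (lang_eq_pw_right h2))
  right; right
  apply h.antisymm
  obtain ⟨W1, ⟨i1, m1, rfl⟩, hW1⟩ := Set.not_subset.1 h1
  obtain ⟨W2, ⟨i2, m2, rfl⟩, hW2⟩ := Set.not_subset.1 h2
  obtain ⟨a, n, ha1, ha2, hn1, hn2⟩ : ∃ (a : ℤ) (n : ℕ), a ≤ i1 ∧ a ≤ i2 ∧ i1 + m1 ≤ a + n ∧
      i2 + m2 ≤ a + n :=
    ⟨min i1 i2, (max (i1 + m1) (i2 + m2) - min i1 i2).toNat, by omega, by omega, by omega, by omega⟩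
  have hw1 := factor_infix x ha1 hn1
  have hw2 := factor_infix x ha2 hn2
  rintro w ⟨j, hw⟩
  refine lang_infix hw ?_
  set N := f.length + j * y.length + j * z.length with hN
  obtain ⟨k, p, q, hk⟩ := h ⟨a - N, N + n + N, rfl⟩
  have hlen := congrArg List.length hk
  simp only [List.length_append, pw_length, factor_length] at hlen
  have hk2 := hk
  rw [factor_add, factor_add, show a - (N : ℤ) + N = a by ring] at hk2
  have c1 : k * y.length < p.length + N + n := by
    by_contra hc
    apply hW1
    refine ⟨k, hw1.trans ?_⟩
    simp only [pw_nil, List.append_nil]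
    have : p ++ factor x (a - N) N ++ factor x a n <+: pw y k := by
      refine List.prefix_of_prefix_length_le (l₃ := pw y k ++ f ++ pw z k) ?_ ?_ ?_
      · rw [← hk2]
        exact ⟨factor x (a - N + ((N + n : ℕ) : ℤ)) N ++ q, by simp⟩
      · exact ⟨f ++ pw z k, by simp⟩
      · simp; omega
    obtain ⟨r, hr⟩ := this
    exact ⟨p ++ factor x (a - N) N, r, hr⟩
  have c2 : k * z.length < q.length + N + n := by
    by_contra hc
    apply hW2
    refine ⟨k, hw2.trans ?_⟩
    simp only [pw_nil, List.append_nil, List.nil_append]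
    have : factor x a n ++ (factor x (a - N + ((N + n : ℕ) : ℤ)) N ++ q) <:+ pw z k := by
      refine List.suffix_of_suffix_length_le (l₃ := pw y k ++ f ++ pw z k) ?_ ?_ ?_
      · rw [← hk2]
        exact ⟨p ++ factor x (a - N) N, by simp⟩
      · exact ⟨pw y k ++ f, by simp⟩
      · simp; omega
    obtain ⟨r, hr⟩ := this
    exact ⟨r, factor x (a - N + ((N + n : ℕ) : ℤ)) N ++ q, by rw [← hr]; simp⟩
  have hjk : j ≤ k := by
    have : j * z.length < k * z.length := by omega
    exact (lt_of_mul_lt_mul_right this (Nat.zero_le _)).le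
  obtain ⟨r, rfl⟩ := Nat.exists_eq_add_of_le hjk
  have e1 : (j + r) * y.length = j * y.length + r * y.length := by ring
  have e2 : (j + r) * z.length = j * z.length + r * z.length := by ring
  have e3 : pw y (j + r) = pw y r ++ pw y j := by rw [add_comm, pw_add]
  refine lang_infix (cover (p := p) (q := q) (p2 := pw y r) (q2 := pw z r) (W := factor x (a - N) (N + n + N))
    (V := pw y j ++ f ++ pw z j) ?_ ?_ ?_) ⟨_, _, rfl⟩
  · rw [hk, e3, pw_add]; simp
  · simp; omega
  · simp; omega

lemma finite_words [Finite A] (M : ℕ) : {w : List A | w.length ≤ M}.Finite :=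
  List.finite_length_le A M

lemma case1 [Finite A] (T : Setting A) :
    {U : Set (List A) | ∃ x ∈ T.X, (∀ i, x i ∈ T.B) ∧ U = lang x}.Finite := by
  obtain ⟨M, hM1, hM2, hM⟩ := T.gap_thm
  have hfin3 : ({w : List A | w.length ≤ M} ×ˢ ({w : List A | w.length ≤ M} ×ˢ
    {w : List A | w.length ≤ M})).Finite :=
    (finite_words M).prod ((finite_words M).prod (finite_words M))
  refine ((hfin3.image (fun t => Sub1 t.1 [] [])).union ((hfin3.image (fun t => Sub1 [] [] t.2.2)).union
    (hfin3.image (fun t => Sub1 t.1 t.2.1 t.2.2)))).subset ?_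
  rintro U ⟨x, hx, hB, rfl⟩
  have key : ∀ m : ℕ, ∃ t : List A × List A × List A, t ∈ ({w : List A | w.length ≤ M} ×ˢ
      ({w : List A | w.length ≤ M} ×ˢ {w : List A | w.length ≤ M})) ∧
      factor x (-m) (2 * m + 1) ∈ Sub1 t.1 t.2.1 t.2.2 := by
    intro m
    obtain ⟨g, h, β1, β2, hg⟩ := gap_of_mid (hx.1 (-m - M) (M + (2 * m + 1) + M))
      (fun c hc => by obtain ⟨t, -, -, rfl⟩ := mem_factor.1 hc; exact hB t)
      (List.ne_nil_of_length_pos (by simp))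
    rcases hM _ _ _ hg with hl | ⟨v, v', f, k, hv, hv', hf, -, he⟩
    · simp at hl; omega
    have b1 := hv.length_le
    have b2 := hv'.length_le
    refine ⟨(F T.σ v, f, F T.σ v'), ⟨?_, hf, ?_⟩, k, ?_⟩
    · obtain ⟨⟨s, hs⟩, -⟩ := hv
      have := hM2 g
      rw [hs] at this
      simp at this ⊢; omega
    · obtain ⟨⟨s, hs⟩, -⟩ := hv'
      have := hM2 h
      rw [hs] at this
      simp at this ⊢; omega
    · rw [factor_add, factor_add, show -(m : ℤ) - M + M = -m by ring] at he
      refine cover (p := v) (q := v') (p2 := β1 ++ factor x (-m - M) M)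
        (q2 := factor x (-m - M + ((M + (2 * m + 1) : ℕ) : ℤ)) M ++ β2) ?_ ?_ ?_
      · rw [← he]; simp
      · have := hM1 g; simp; omega
      · have := hM1 h; simp; omega
  choose t ht hsub using key
  obtain ⟨a, ha, hinf⟩ := pigeon t _ hfin3 0 (fun m _ => ht m)
  have hlang : lang x ⊆ Sub1 a.1 a.2.1 a.2.2 := by
    rintro w ⟨i, n, rfl⟩
    obtain ⟨m, hm, rfl⟩ := hinf (i.natAbs + n)
    obtain ⟨k, hk⟩ := hsub m
    refine ⟨k, (factor_infix x ?_ ?_).trans hk⟩ <;> push_cast <;> omega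
  rcases lang_trichotomy hlang with h | h | h
  · exact Or.inl ⟨a, ha, h.symm⟩
  · exact Or.inr (Or.inl ⟨a, ha, h.symm⟩)
  · exact Or.inr (Or.inr ⟨a, ha, h.symm⟩)

/-! ### Reversal -/

def srev (σ : A → List A) : A → List A := fun a => (σ a).reverse

lemma F_srev (σ : A → List A) (w : List A) : F (srev σ) w.reverse = (F σ w).reverse := by
  induction w with
  | nil => rfl
  | cons a w ih => simp [ih, srev]

lemma Fit_srev (σ : A → List A) (n : ℕ) (w : List A) :
    (F (srev σ))^[n] w.reverse = ((F σ)^[n] w).reverse := by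
  induction n generalizing w with
  | zero => rfl
  | succ n ih => rw [Function.iterate_succ_apply, Function.iterate_succ_apply, F_srev, ih]

lemma eq_rev {u w : List A} (h : u.reverse = w) : u = w.reverse := by rw [← h]; simp

def rev (T : Setting A) : Setting A where
  σ := srev T.σ
  S := List.reverse '' T.S
  B := T.B
  star := T.star
  finS := T.finS.image _
  ne := fun a h => T.ne a (by simpa [srev] using h)
  starB := T.starB
  hstar := by simp [srev, T.hstar]
  hB := fun b hb c hc => T.hB b hb c (by simpa [srev] using hc)
  hG := fun g hg => by simpa [srev] using T.hG g hg
  idem := fun b hb => by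
    show F (srev T.σ) (T.σ b).reverse = (T.σ b).reverse
    rw [F_srev, T.idem b hb]
  hL := fun a g s t h hg ht => by
    have h1 : T.σ a = t.reverse ++ g :: s.reverse := by
      rw [eq_rev (show (T.σ a).reverse = _ from h)]; simp
    obtain ⟨s', t', h2, h3⟩ := T.hR a g s.reverse t.reverse h1 hg (by simpa using ht)
    exact ⟨s'.reverse, t'.reverse, by simp [srev, h2], by simpa using h3⟩
  hR := fun a g s t h hg ht => by
    have h1 : T.σ a = s.reverse ++ g :: t.reverse := by
      rw [eq_rev (show (T.σ a).reverse = _ from h)]; simp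
    obtain ⟨s', t', h2, h3⟩ := T.hL a g s.reverse t.reverse h1 hg (by simpa using ht)
    exact ⟨s'.reverse, t'.reverse, by simp [srev, h2], by simpa using h3⟩
  grow := fun K => by
    obtain ⟨n0, h⟩ := T.grow K
    refine ⟨n0, fun n hn g hg hs => ?_⟩
    have := h n hn g hg hs
    have e := Fit_srev T.σ n [g]
    rw [List.reverse_singleton] at e
    rw [e]; simpa using this

def xrev (x : ℤ → A) : ℤ → A := fun i => x (-i)

lemma factor_xrev (x : ℤ → A) (i : ℤ) (m : ℕ) :
    factor (xrev x) i m = (factor x (-i - m + 1) m).reverse := by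
  induction m generalizing i with
  | zero => rfl
  | succ m ih =>
    rw [factor_succ, ih, factor_succ', List.reverse_append]
    simp only [List.reverse_singleton, List.singleton_append, xrev]
    congr 2 <;> push_cast
    · congr 1; ring
    · congr 1; ring

lemma X_rev {x : ℤ → A} (hx : x ∈ T.X) : xrev x ∈ T.rev.X := by
  refine ⟨fun i m => ?_, fun i => hx.2 _⟩
  obtain ⟨n, s, hs, h⟩ := hx.1 (-i - m + 1) m
  refine ⟨n, s.reverse, ⟨s, hs, rfl⟩, ?_⟩
  rw [factor_xrev]
  have e := Fit_srev T.σ n (T.star :: s ++ [T.star])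
  have e2 : (T.star :: s ++ [T.star]).reverse = T.star :: s.reverse ++ [T.star] := by simp
  rw [e2] at e
  show _ <:+: (F (srev T.σ))^[n] (T.star :: s.reverse ++ [T.star])
  rw [e]
  exact List.reverse_infix.2 h

lemma Rep_rev {σ : A → List A} {x x' : ℤ → A} {d : ℤ → ℤ} (h : Rep (F σ) x x' d) :
    Rep (F (srev σ)) (xrev x) (xrev x') (fun i => 1 - d (1 - i)) := by
  refine ⟨fun i j hij => ?_, fun i m => ?_⟩
  · have := h.1 (show 1 - j < 1 - i by omega)
    simp only; omega
  · rw [factor_xrev, F_srev, h.2, factor_xrev]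
    have e1 : -i - (m : ℤ) + 1 + m = 1 - i := by ring
    have e2 : -i - (m : ℤ) + 1 = 1 - (i + m) := by ring
    rw [e1, e2]
    have := h.1.monotone (show 1 - (i + (m : ℤ)) ≤ 1 - i by omega)
    have e3 : (1 - d (1 - (i + ↑m)) - (1 - d (1 - i))).toNat = (d (1 - i) - d (1 - (i + ↑m))).toNat := by
      congr 1; ring
    simp only [e3]
    congr 2
    omega

/-! ### Towers -/

structure Tower (T : Setting A) (x : ℕ → ℤ → A) (d : ℕ → ℤ → ℤ) : Prop where
  hX : ∀ n, x n ∈ T.X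
  rep : ∀ n, Rep (F T.σ) (x n) (x (n + 1)) (d n)
  d0 : ∀ n, d n 0 ≤ 0
  d1 : ∀ n, 0 < d n 1
  hB : ∀ n, x n 0 ∉ T.B

lemma Tower.rev {x : ℕ → ℤ → A} {d : ℕ → ℤ → ℤ} (h : Tower T x d) :
    Tower T.rev (fun n => xrev (x n)) (fun n i => 1 - d n (1 - i)) where
  hX := fun n => X_rev (h.hX n)
  rep := fun n => Rep_rev (h.rep n)
  d0 := fun n => by have := h.d1 n; simp; omega
  d1 := fun n => by have := h.d0 n; simp; omega
  hB := fun n => by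
    show x n (-0) ∉ T.B
    simpa using h.hB n

def cc (d : ℕ → ℤ → ℤ) : ℕ → ℤ → ℤ
  | 0 => id
  | n + 1 => cc d n ∘ d n

lemma cc_rev (d : ℕ → ℤ → ℤ) (n : ℕ) (i : ℤ) :
    cc (fun n i => 1 - d n (1 - i)) n i = 1 - cc d n (1 - i) := by
  induction n generalizing i with
  | zero => simp [cc]
  | succ n ih => simp [cc, ih]

lemma Tower.rep_cc {x : ℕ → ℤ → A} {d : ℕ → ℤ → ℤ} (h : Tower T x d) (n : ℕ) :
    Rep ((F T.σ)^[n]) (x 0) (x n) (cc d n) := by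
  induction n with
  | zero => exact ⟨strictMono_id, fun i m => by simp [cc]⟩
  | succ n ih =>
    rw [Function.iterate_succ]
    exact ih.comp (h.rep n)

lemma Tower.cc_zero {x : ℕ → ℤ → A} {d : ℕ → ℤ → ℤ} (h : Tower T x d) (n : ℕ) :
    cc d (n + 1) 0 ≤ cc d n 0 := (h.rep_cc n).1.monotone (h.d0 n)

lemma Tower.cc_nonpos {x : ℕ → ℤ → A} {d : ℕ → ℤ → ℤ} (h : Tower T x d) (n : ℕ) :
    cc d n 0 ≤ 0 := by
  induction n with
  | zero => simp [cc]
  | succ n ih => exact (h.cc_zero n).trans ih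

lemma ev_const (f : ℕ → ℕ) (n0 : ℕ) (h : ∀ n, n0 ≤ n → f (n + 1) ≤ f n) :
    ∃ n1, n0 ≤ n1 ∧ ∀ n, n1 ≤ n → f n = f n1 := by
  have hne : ({k | ∃ n, n0 ≤ n ∧ f n = k} : Set ℕ).Nonempty := ⟨_, n0, le_rfl, rfl⟩
  obtain ⟨n1, h1, h2⟩ := Nat.sInf_mem hne
  refine ⟨n1, h1, fun n hn => le_antisymm ?_ ?_⟩
  · induction n, hn using Nat.le_induction with
    | base => exact le_rfl
    | succ n hn ih => exact (h n (h1.trans hn)).trans ih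
  · rw [h2]; exact Nat.sInf_le ⟨n, h1.trans hn, rfl⟩

lemma ev_const_int (f : ℕ → ℤ) (K : ℤ) (h : ∀ n, f (n + 1) ≤ f n) (hK : ∀ n, K ≤ f n) :
    ∃ n1, ∀ n, n1 ≤ n → f n = f n1 := by
  obtain ⟨n1, -, h1⟩ := ev_const (fun n => (f n - K).toNat) 0 (fun n _ => by
    have := h n; have := hK n; omega)
  refine ⟨n1, fun n hn => ?_⟩
  have := h1 n hn
  have := hK n; have := hK n1
  omega

def Suf (y f : List A) : Set (List A) := {w | ∃ k, w <:+ pw y k ++ f}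

def LeftGood (x : ℕ → ℤ → A) (d : ℕ → ℤ → ℤ) (LF : Set (Set (List A))) : Prop :=
  ∃ (n1 : ℕ) (E : ℕ → Set ℕ),
    (∀ n, n1 ≤ n → {w | ∃ m ∈ E n, w = factor (x n) (-(m : ℤ)) m} ∈ LF) ∧
    (∀ n, n1 ≤ n → ∀ m ∈ E n, ∃ m' ∈ E (n + 1), d n (-(m' : ℤ)) ≤ -(m : ℤ)) ∧
    (∀ K : ℕ, ∃ n, n1 ≤ n ∧ ∃ m ∈ E n, cc d n (-(m : ℤ)) ≤ -(K : ℤ))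

lemma factor_suffix (x : ℤ → A) {m n : ℕ} (h : m ≤ n) :
    factor x (-(m : ℤ)) m <:+ factor x (-(n : ℤ)) n := by
  refine ⟨factor x (-(n : ℤ)) (n - m), ?_⟩
  have e : n = (n - m) + m := by omega
  conv_rhs => rw [show factor x (-(n : ℤ)) n = factor x (-(n : ℤ)) ((n - m) + m) by rw [← e]]
  rw [factor_add]
  congr 2
  omega

lemma suf_mono {y f : List A} {j k : ℕ} (h : j ≤ k) : pw y j ++ f <:+ pw y k ++ f := by
  obtain ⟨r, rfl⟩ := Nat.exists_eq_add_of_le h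
  rw [add_comm, pw_add]
  exact ⟨pw y r, by simp⟩

lemma suf_eq {x : ℤ → A} {y f : List A} (h : ∀ m : ℕ, factor x (-(m : ℤ)) m ∈ Suf y f) :
    {w | ∃ m ∈ (Set.univ : Set ℕ), w = factor x (-(m : ℤ)) m} = Suf y f := by
  ext w
  constructor
  · rintro ⟨m, -, rfl⟩; exact h m
  · rintro ⟨k, hk⟩
    obtain ⟨k', hk'⟩ := h w.length
    refine ⟨w.length, trivial, ?_⟩
    have h1 := hk.trans (suf_mono (le_max_left k k'))
    have h2 := hk'.trans (suf_mono (le_max_right k k'))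
    have h3 := List.suffix_of_suffix_length_le h1 h2 (by simp)
    exact h3.eq_of_length (by simp)

lemma left_good [Finite A] (T : Setting A) : ∃ LF : Set (Set (List A)), LF.Finite ∧
    ∀ x d, Tower T x d → LeftGood x d LF := by
  obtain ⟨M, hM1, hM2, hM⟩ := T.gap_thm
  have hfin2 : ({w : List A | w.length ≤ M} ×ˢ {w : List A | w.length ≤ M}).Finite :=
    (finite_words M).prod (finite_words M)
  refine ⟨((fun u => {u}) '' {w : List A | w.length ≤ M + 1}) ∪
    ((fun t : List A × List A => Suf t.1 t.2) '' ({w : List A | w.length ≤ M} ×ˢ {w : List A | w.length ≤ M})),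
    ((finite_words _).image _).union (hfin2.image _), fun x d H => ?_⟩
  by_cases hL1 : ∀ K : ℕ, ∃ n, cc d n 0 ≤ -(K : ℤ)
  · refine ⟨0, fun _ => {0}, fun n _ => Or.inl ⟨[], by simp, ?_⟩, fun n _ m hm => ?_, fun K => ?_⟩
    · ext w; simp
    · obtain rfl : m = 0 := hm
      exact ⟨0, rfl, by simpa using H.d0 n⟩
    · obtain ⟨n, hn⟩ := hL1 K
      exact ⟨n, Nat.zero_le _, 0, rfl, by simpa using hn⟩
  push Not at hL1
  obtain ⟨K0, hK0⟩ := hL1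
  obtain ⟨n0, hn0⟩ := ev_const_int (fun n => cc d n 0) (-(K0 : ℤ)) H.cc_zero (fun n => (hK0 n).le)
  have hd0 : ∀ n, n0 ≤ n → d n 0 = 0 := by
    intro n hn
    apply (H.rep_cc n).1.injective
    have h1 := hn0 n hn
    have h2 := hn0 (n + 1) (by omega)
    rw [h1, ← h2]; rfl
  have hrel : ∀ n, n0 ≤ n → T.RelR (x (n + 1) 0) (x n 0) [] := by
    intro n hn
    refine ⟨?_, H.hB n, by simp⟩
    have h1 := (H.rep n).single 0
    have h2 := H.d1 n
    rw [zero_add, hd0 n hn, sub_zero] at h1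
    rw [show (d n 1).toNat = ((d n 1).toNat - 1) + 1 by omega, factor_succ] at h1
    exact ⟨_, h1⟩
  have hself : ∀ n, n0 + 1 ≤ n → T.RelR (x n 0) (x n 0) [] := by
    intro n hn
    obtain ⟨n, rfl⟩ : ∃ k, n = k + 1 := ⟨n - 1, by omega⟩
    obtain ⟨v, hv⟩ := (hrel (n + 1) (by omega)).fix
    obtain ⟨h1, h2⟩ := hv.unique (hrel n (by omega))
    rwa [h2] at hv
  by_cases hL3 : ∀ n, n0 + 1 ≤ n → ∀ i < 0, x n i ∈ T.B
  · refine ⟨n0 + 1, fun _ => Set.univ, fun n hn => Or.inr ?_, fun n hn m _ => ?_, fun K => ?_⟩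
    · have key : ∀ m : ℕ, ∃ t : List A × List A, t ∈ ({w : List A | w.length ≤ M} ×ˢ
          {w : List A | w.length ≤ M}) ∧ factor (x n) (-(m : ℤ)) m ∈ Suf t.1 t.2 := by
        intro m
        have hlg : factor (x n) (-((M + 1 + m : ℕ) : ℤ)) (M + 1 + m) ++ [x n 0] ∈ T.Lg := by
          have := (H.hX n).1 (-((M + 1 + m : ℕ) : ℤ)) (M + 1 + m + 1)
          rw [factor_succ'] at this
          rwa [neg_add_cancel] at this
        obtain ⟨g, β1, hg⟩ := gap_of_left hlg (fun c hc => by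
            obtain ⟨t, h1, h2, rfl⟩ := mem_factor.1 hc; exact hL3 n hn t (by omega))
          (List.ne_nil_of_length_pos (by rw [factor_length]; omega)) (H.hB n)
        rcases hM _ _ _ hg with hl | ⟨v, v', f, k, hv, hv', hf, -, he⟩
        · simp at hl; omega
        have b1 := hv.length_le
        have hv0 : v' = [] := (hv'.unique (hself n hn)).2
        subst hv0
        refine ⟨(F T.σ v, f), ⟨?_, hf⟩, k, ?_⟩
        · obtain ⟨⟨s, hs⟩, -⟩ := hv
          have := hM2 g
          rw [hs] at this
          simp at this ⊢; omega
        · simp only [F_nil, pw_nil, List.append_nil] at he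
          have h1 : factor (x n) (-(m : ℤ)) m <:+ v ++ (pw (F T.σ v) k ++ f) := by
            rw [← he]
            exact (factor_suffix (x n) (by omega)).trans (List.suffix_append _ _)
          refine List.suffix_of_suffix_length_le h1 (List.suffix_append _ _) ?_
          have hl := congrArg List.length he
          simp only [List.length_append, factor_length] at hl ⊢
          have := hM1 g
          omega
      choose t ht hsub using key
      obtain ⟨a, ha, hinf⟩ := pigeon t _ hfin2 0 (fun m _ => ht m)
      refine ⟨a, ha, (suf_eq fun m => ?_).symm⟩
      obtain ⟨m', hm', rfl⟩ := hinf m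
      obtain ⟨k, hk⟩ := hsub m'
      exact ⟨k, (factor_suffix (x n) hm').trans hk⟩
    · refine ⟨m, trivial, ?_⟩
      have := strictMono_gap (H.rep n).1 (show -(m : ℤ) ≤ 0 by omega)
      rw [hd0 n (by omega)] at this
      omega
    · refine ⟨n0 + 1, le_rfl, K, trivial, ?_⟩
      have := strictMono_gap (H.rep_cc (n0 + 1)).1 (show -(K : ℤ) ≤ 0 by omega)
      have := H.cc_nonpos (n0 + 1)
      omega
  push Not at hL3
  obtain ⟨n2, hn2, i2, hi2, hiB⟩ := hL3
  set Q : ℕ → Set ℕ := fun n => {m | 1 ≤ m ∧ x n (-(m : ℤ)) ∉ T.B} with hQ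
  -- parent of a non-B letter
  have hpar : ∀ n, n0 + 1 ≤ n → ∀ m ∈ Q n, ∃ j ∈ Q (n + 1), j ≤ m ∧ d n (-(j : ℤ)) ≤ -(m : ℤ) ∧
      -(m : ℤ) < d n (-(j : ℤ) + 1) := by
    rintro n hn m ⟨hm1, hm2⟩
    obtain ⟨j, hj1, hj2⟩ := exists_index (H.rep n).1 (-(m : ℤ))
    have hz := hd0 n (by omega)
    have hj0 : j < 0 := by
      by_contra hc
      have := (H.rep n).1.monotone (show 0 ≤ j by omega)
      omega
    have hg := strictMono_gap (H.rep n).1 (show j + 1 ≤ 0 by omega)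
    refine ⟨(-j).toNat, ⟨by omega, ?_⟩, by omega, ?_, ?_⟩
    · rw [show -((-j).toNat : ℤ) = j by omega]
      intro hB
      apply hm2
      apply T.hB _ hB
      rw [(H.rep n).single j]
      exact mem_factor.2 ⟨_, hj1, by omega, rfl⟩
    · rwa [show -((-j).toNat : ℤ) = j by omega]
    · rwa [show -((-j).toNat : ℤ) = j by omega]
  have hQne : ∀ n, n2 ≤ n → (Q n).Nonempty := by
    intro n hn
    induction n, hn using Nat.le_induction with
    | base => exact ⟨(-i2).toNat, by omega, by rwa [show -((-i2).toNat : ℤ) = i2 by omega]⟩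
    | succ n hn ih =>
      obtain ⟨m, hm⟩ := ih
      obtain ⟨j, hj, -⟩ := hpar n (by omega) m hm
      exact ⟨j, hj⟩
  have hdec : ∀ n, n2 ≤ n → sInf (Q (n + 1)) ≤ sInf (Q n) := by
    intro n hn
    obtain ⟨j, hj, hjm, -⟩ := hpar n (by omega) _ (Nat.sInf_mem (hQne n hn))
    exact (Nat.sInf_le hj).trans hjm
  obtain ⟨n3, hn3, hconst⟩ := ev_const (fun n => sInf (Q n)) n2 hdec
  set μ := sInf (Q n3) with hμ
  have hμmem : ∀ n, n3 ≤ n → μ ∈ Q n := by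
    intro n hn
    rw [← hconst n hn]; exact Nat.sInf_mem (hQne n (by omega))
  have hμ1 : 1 ≤ μ := (hμmem n3 le_rfl).1
  have hstep : ∀ n, n3 ≤ n → d n (-(μ : ℤ)) ≤ -(μ : ℤ) ∧ d n (-(μ : ℤ) + 1) = -(μ : ℤ) + 1 := by
    intro n hn
    obtain ⟨j, hj, hjm, h1, h2⟩ := hpar n (by omega) _ (hμmem n hn)
    have h3 := Nat.sInf_le hj
    rw [hconst (n + 1) (by omega)] at h3
    have hjμ : j = μ := le_antisymm hjm h3
    rw [hjμ] at h1 h2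
    refine ⟨h1, ?_⟩
    have := strictMono_gap (H.rep n).1 (show -(μ : ℤ) + 1 ≤ 0 by omega)
    rw [hd0 n (by omega)] at this
    omega
  have hrelL : ∀ n, n3 ≤ n → T.RelL (x (n + 1) (-(μ : ℤ))) (x n (-(μ : ℤ))) [] := by
    intro n hn
    obtain ⟨h1, h2⟩ := hstep n hn
    refine ⟨?_, (hμmem n hn).2, by simp⟩
    have h3 := (H.rep n).single (-(μ : ℤ))
    rw [h2, show (-(μ : ℤ) + 1 - d n (-(μ : ℤ))).toNat = (-(μ : ℤ) - d n (-(μ : ℤ))).toNat + 1 by omega,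
      factor_succ', show d n (-(μ : ℤ)) + ((-(μ : ℤ) - d n (-(μ : ℤ))).toNat : ℤ) = -(μ : ℤ) by omega] at h3
    exact ⟨_, h3⟩
  have hselfL : ∀ n, n3 + 1 ≤ n → T.RelL (x n (-(μ : ℤ))) (x n (-(μ : ℤ))) [] := by
    intro n hn
    obtain ⟨n, rfl⟩ : ∃ k, n = k + 1 := ⟨n - 1, by omega⟩
    obtain ⟨v, hv⟩ := (hrelL (n + 1) (by omega)).fix
    obtain ⟨h1, h2⟩ := hv.unique (hrelL n (by omega))
    rwa [h2] at hv
  have hbound : μ ≤ M + 1 := by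
    set n := n3 + 1 with hn
    have hlg := (H.hX n).1 (-(μ : ℤ)) (1 + (μ - 1) + 1)
    rw [factor_succ', factor_add, factor_one, show -(μ : ℤ) + ((1 + (μ - 1) : ℕ) : ℤ) = 0 by omega] at hlg
    have hg := gap_of_both (β := factor (x n) (-(μ : ℤ) + ((1 : ℕ) : ℤ)) (μ - 1)) hlg ?_ (hμmem n (by omega)).2 (H.hB n)
    · rcases hM _ _ _ hg with hl | ⟨v, v', f, k, hv, hv', hf, -, he⟩
      · simp at hl; omega
      have e1 : v = [] := (hv.unique (hselfL n (by omega))).2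
      have e2 : v' = [] := (hv'.unique (hself n (by omega))).2
      subst e1; subst e2
      have := congrArg List.length he
      simp at this
      omega
    · intro c hc
      obtain ⟨t, h1, h2, rfl⟩ := mem_factor.1 hc
      by_contra hc
      have h4 : (-t).toNat ∈ Q n := ⟨by omega, by rwa [show -((-t).toNat : ℤ) = t by omega]⟩
      have h3 := Nat.sInf_le h4
      rw [hconst n (by omega)] at h3
      omega
  refine ⟨n3 + 1, fun _ => {μ}, fun n hn => Or.inl ⟨factor (x n) (-(μ : ℤ)) μ, by simpa using hbound, ?_⟩,
    fun n hn m hm => ?_, fun K => ?_⟩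
  · ext w; simp
  · have hm' : m = μ := hm
    rw [hm']
    exact ⟨μ, rfl, (hstep n (by omega)).1⟩
  · obtain ⟨N, hN⟩ := T.grow K
    set n := max N (n3 + 1) with hn
    refine ⟨n, le_max_right _ _, μ, rfl, ?_⟩
    have h1 := hN n (le_max_left _ _) (x n (-(μ : ℤ))) (hμmem n (by omega)).2 ((H.hX n).2 _)
    have h2 := (H.rep_cc n).2 (-(μ : ℤ)) 1
    rw [factor_one] at h2
    rw [h2, factor_length] at h1
    have h3 := H.cc_nonpos n
    have h4 := (H.rep_cc n).1.monotone (show -(μ : ℤ) + ((1 : ℕ) : ℤ) ≤ 0 by omega)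
    by_contra hc
    rcases Nat.eq_zero_or_pos K with h | h
    · have := (H.rep_cc n).1.monotone (show -(μ : ℤ) ≤ 0 by omega)
      omega
    · omega

def RightGood (x : ℕ → ℤ → A) (d : ℕ → ℤ → ℤ) (LF : Set (Set (List A))) : Prop :=
  ∃ (n1 : ℕ) (E : ℕ → Set ℕ),
    (∀ n, n1 ≤ n → {w | ∃ m ∈ E n, w = factor (x n) 1 m} ∈ LF) ∧
    (∀ n, n1 ≤ n → ∀ m ∈ E n, ∃ m' ∈ E (n + 1), (m : ℤ) + 1 ≤ d n ((m' : ℤ) + 1)) ∧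
    (∀ K : ℕ, ∃ n, n1 ≤ n ∧ ∃ m ∈ E n, (K : ℤ) ≤ cc d n ((m : ℤ) + 1))

lemma right_good [Finite A] (T : Setting A) : ∃ LF : Set (Set (List A)), LF.Finite ∧
    ∀ x d, Tower T x d → RightGood x d LF := by
  obtain ⟨LF, hLF, h⟩ := left_good T.rev
  refine ⟨(fun s => {w | w.reverse ∈ s}) '' LF, hLF.image _, fun x d H => ?_⟩
  obtain ⟨n1, E, h1, h2, h3⟩ := h _ _ H.rev
  refine ⟨n1, E, fun n hn => ⟨_, h1 n hn, ?_⟩, fun n hn m hm => ?_, fun K => ?_⟩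
  · ext w
    simp only [Set.mem_ofPred_eq]
    apply exists_congr
    intro m
    apply and_congr_right
    intro _
    rw [factor_xrev, List.reverse_inj, neg_neg, sub_self, zero_add]
  · obtain ⟨m', hm', h4⟩ := h2 n hn m hm
    refine ⟨m', hm', ?_⟩
    beta_reduce at h4
    rw [sub_neg_eq_add, add_comm 1 (m' : ℤ)] at h4
    omega
  · obtain ⟨n, hn, m, hm, h4⟩ := h3 K
    refine ⟨n, hn, m, hm, ?_⟩
    rw [cc_rev, sub_neg_eq_add, add_comm 1 (m : ℤ)] at h4
    omega

/-- infix closure of the image -/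
def Phi (σ : A → List A) (L : Set (List A)) : Set (List A) := {w | ∃ u ∈ L, w <:+: F σ u}

lemma Phi_mono (σ : A → List A) : Monotone (Phi σ) := by
  rintro L L' h w ⟨u, hu, hw⟩
  exact ⟨u, h hu, hw⟩

lemma Phi_iter (σ : A → List A) {L : Set (List A)} (hL : ∀ u ∈ L, ∀ w, w <:+: u → w ∈ L) (n : ℕ)
    (w : List A) : w ∈ (Phi σ)^[n] L ↔ ∃ u ∈ L, w <:+: (F σ)^[n] u := by
  induction n generalizing w with
  | zero =>
    constructor
    · intro h; exact ⟨w, h, List.infix_rfl⟩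
    · rintro ⟨u, hu, h⟩; exact hL u hu w h
  | succ n ih =>
    rw [Function.iterate_succ_apply']
    constructor
    · rintro ⟨u, hu, hw⟩
      obtain ⟨v, hv, huv⟩ := (ih u).1 hu
      refine ⟨v, hv, ?_⟩
      rw [Function.iterate_succ_apply']
      exact hw.trans (F_infix σ huv)
    · rintro ⟨u, hu, hw⟩
      rw [Function.iterate_succ_apply'] at hw
      exact ⟨_, (ih _).2 ⟨u, hu, List.infix_rfl⟩, hw⟩

lemma tower_exists [Finite A] {x : ℤ → A} (hx : x ∈ T.X) (h0 : x 0 ∉ T.B) :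
    ∃ X D, Tower T X D ∧ X 0 = x := by
  choose! f hf d hd using fun (x : ℤ → A) (hx : x ∈ T.X) => desub hx
  have hB : ∀ y ∈ T.X, y 0 ∉ T.B → f y 0 ∉ T.B := by
    intro y hy hy0 hc
    obtain ⟨h1, h2, h3⟩ := hd y hy
    apply hy0
    apply T.hB _ hc
    rw [h1.single 0]
    exact mem_factor.2 ⟨0, h2, by rw [zero_add]; omega, rfl⟩
  have hall : ∀ n, f^[n] x ∈ T.X ∧ f^[n] x 0 ∉ T.B := by
    intro n
    induction n with
    | zero => exact ⟨hx, h0⟩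
    | succ n ih =>
      rw [Function.iterate_succ_apply']
      exact ⟨hf _ ih.1, hB _ ih.1 ih.2⟩
  refine ⟨fun n => f^[n] x, fun n => d (f^[n] x), ⟨fun n => (hall n).1, fun n => ?_, fun n => ?_,
    fun n => ?_, fun n => (hall n).2⟩, rfl⟩
  · simp only [Function.iterate_succ_apply']
    exact (hd _ (hall n).1).1
  · exact (hd _ (hall n).1).2.1
  · exact (hd _ (hall n).1).2.2

lemma X_shift {x : ℤ → A} (hx : x ∈ T.X) (k : ℤ) : (fun n => x (n + k)) ∈ T.X :=
  ⟨fun i m => by rw [factor_shift]; exact hx.1 _ _, fun i => hx.2 _⟩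

lemma case2 [Finite A] (T : Setting A) :
    {U : Set (List A) | ∃ x ∈ T.X, (∃ i, x i ∉ T.B) ∧ U = lang x}.Finite := by
  obtain ⟨LF, hLF, hleft⟩ := left_good T
  obtain ⟨RF, hRF, hright⟩ := right_good T
  have hfin : (LF ×ˢ ((Set.univ : Set A) ×ˢ RF)).Finite := hLF.prod (Set.finite_univ.prod hRF)
  refine (finite_chain (Phi T.σ) (Phi_mono T.σ)
    ((fun t : Set (List A) × A × Set (List A) =>
      {w : List A | ∃ a ∈ t.1, ∃ b ∈ t.2.2, w <:+: a ++ t.2.1 :: b}) '' _)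
    (hfin.image _)).subset ?_
  rintro U ⟨x', hx', ⟨i, hi⟩, rfl⟩
  rw [← lang_shift x' i]
  obtain ⟨x, d, H, hx0⟩ := tower_exists (X_shift hx' i) (by simpa using hi)
  rw [← hx0]
  obtain ⟨n1, E, hE1, hE2, hE3⟩ := hleft x d H
  obtain ⟨n2, G, hG1, hG2, hG3⟩ := hright x d H
  have hLset : ∀ n, {w : List A | ∃ a ∈ {w | ∃ m ∈ E n, w = factor (x n) (-(m : ℤ)) m},
      ∃ b ∈ {w | ∃ m ∈ G n, w = factor (x n) 1 m}, w <:+: a ++ x n 0 :: b} =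
      {w | ∃ m ∈ E n, ∃ m' ∈ G n, w <:+: factor (x n) (-(m : ℤ)) (m + (m' + 1))} := by
    intro n
    have e : ∀ m m' : ℕ, factor (x n) (-(m : ℤ)) (m + (m' + 1)) =
        factor (x n) (-(m : ℤ)) m ++ x n 0 :: factor (x n) 1 m' := by
      intro m m'
      rw [factor_add, neg_add_cancel, factor_succ, zero_add]
    ext w
    constructor
    · rintro ⟨a, ⟨m, hm, rfl⟩, b, ⟨m', hm', rfl⟩, hw⟩
      exact ⟨m, hm, m', hm', by rwa [e]⟩
    · rintro ⟨m, hm, m', hm', hw⟩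
      exact ⟨_, ⟨m, hm, rfl⟩, _, ⟨m', hm', rfl⟩, by rwa [e] at hw⟩
  set L : ℕ → Set (List A) := fun n =>
    {w | ∃ m ∈ E n, ∃ m' ∈ G n, w <:+: factor (x n) (-(m : ℤ)) (m + (m' + 1))} with hL
  have hLinf : ∀ n, ∀ u ∈ L n, ∀ w, w <:+: u → w ∈ L n := by
    rintro n u ⟨m, hm, m', hm', hu⟩ w hw
    exact ⟨m, hm, m', hm', hw.trans hu⟩
  refine ⟨L, max n1 n2, fun n hn => ?_, fun n hn => ?_, fun w => ?_⟩
  · exact ⟨(_, x n 0, _), ⟨hE1 n (by omega), trivial, hG1 n (by omega)⟩, hLset n⟩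
  · rintro w ⟨m, hm, m', hm', hw⟩
    obtain ⟨k, hk, hk2⟩ := hE2 n (by omega) m hm
    obtain ⟨k', hk', hk2'⟩ := hG2 n (by omega) m' hm'
    refine ⟨_, ⟨k, hk, k', hk', List.infix_rfl⟩, hw.trans ?_⟩
    rw [(H.rep n).2]
    have e : -(k : ℤ) + ((k + (k' + 1) : ℕ) : ℤ) = k' + 1 := by push_cast; ring
    rw [e]
    apply factor_infix
    · exact hk2
    · push_cast; omega
  · constructor
    · rintro ⟨j, l, rfl⟩
      set K := j.natAbs + l with hK
      have c1 : ∃ N, n1 ≤ N ∧ ∀ n, N ≤ n → ∃ m ∈ E n, cc d n (-(m : ℤ)) ≤ -(K : ℤ) := by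
        obtain ⟨N, hN, m, hm, hc⟩ := hE3 K
        refine ⟨N, hN, fun n hn => ?_⟩
        induction n, hn using Nat.le_induction with
        | base => exact ⟨m, hm, hc⟩
        | succ n hn ih =>
          obtain ⟨m, hm, hc⟩ := ih
          obtain ⟨m', hm', h⟩ := hE2 n (by omega) m hm
          exact ⟨m', hm', ((H.rep_cc n).1.monotone h).trans hc⟩
      have c2 : ∃ N, n2 ≤ N ∧ ∀ n, N ≤ n → ∃ m ∈ G n, (K : ℤ) ≤ cc d n ((m : ℤ) + 1) := by
        obtain ⟨N, hN, m, hm, hc⟩ := hG3 K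
        refine ⟨N, hN, fun n hn => ?_⟩
        induction n, hn using Nat.le_induction with
        | base => exact ⟨m, hm, hc⟩
        | succ n hn ih =>
          obtain ⟨m, hm, hc⟩ := ih
          obtain ⟨m', hm', h⟩ := hG2 n (by omega) m hm
          exact ⟨m', hm', hc.trans ((H.rep_cc n).1.monotone h)⟩
      obtain ⟨N1, hN1, hc1⟩ := c1
      obtain ⟨N2, hN2, hc2⟩ := c2
      set n := max N1 N2 with hn
      refine ⟨n, by omega, ?_⟩
      obtain ⟨m, hm, hmK⟩ := hc1 n (by omega)
      obtain ⟨m', hm', hmK'⟩ := hc2 n (by omega)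
      rw [Phi_iter T.σ (hLinf n)]
      refine ⟨_, ⟨m, hm, m', hm', List.infix_rfl⟩, ?_⟩
      rw [(H.rep_cc n).2]
      have e : -(m : ℤ) + ((m + (m' + 1) : ℕ) : ℤ) = m' + 1 := by push_cast; ring
      rw [e]
      apply factor_infix <;> push_cast <;> omega
    · rintro ⟨n, hn, hw⟩
      rw [Phi_iter T.σ (hLinf n)] at hw
      obtain ⟨u, ⟨m, hm, m', hm', hu⟩, hw⟩ := hw
      have h1 := hw.trans (Fit_infix T.σ n hu)
      rw [(H.rep_cc n).2] at h1
      exact lang_infix h1 ⟨_, _, rfl⟩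

theorem main [Finite A] (T : Setting A) : {U : Set (List A) | ∃ x ∈ T.X, U = lang x}.Finite := by
  refine ((case1 T).union (case2 T)).subset ?_
  rintro U ⟨x, hx, rfl⟩
  by_cases h : ∀ i, x i ∈ T.B
  · exact Or.inl ⟨x, hx, h, rfl⟩
  · push Not at h
    exact Or.inr ⟨x, hx, h, rfl⟩

end Setting

/-! ### Instantiation -/

def Ev (p : ℕ → Prop) : Prop := ∃ q, 0 < q ∧ ∀ P, 0 < P → q ∣ P → p P

lemma Ev.and {p r : ℕ → Prop} (h1 : Ev p) (h2 : Ev r) : Ev (fun P => p P ∧ r P) := by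
  obtain ⟨q, hq, h⟩ := h1
  obtain ⟨q', hq', h'⟩ := h2
  exact ⟨q * q', Nat.mul_pos hq hq', fun P hP hd =>
    ⟨h P hP ((Dvd.intro _ rfl).trans hd), h' P hP ((Dvd.intro_left _ rfl).trans hd)⟩⟩

lemma Ev.all {ι : Type*} [Finite ι] {p : ι → ℕ → Prop} (h : ∀ i, Ev (p i)) :
    Ev (fun P => ∀ i, p i P) := by
  classical
  cases nonempty_fintype ι
  choose q hq h using h
  exact ⟨∏ i, q i, Finset.prod_pos fun i _ => hq i, fun P hP hd i =>
    h i P hP ((Finset.dvd_prod_of_mem q (Finset.mem_univ i)).trans hd)⟩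

lemma Ev.mono {p r : ℕ → Prop} (h1 : Ev p) (h2 : ∀ P, p P → r P) : Ev r := by
  obtain ⟨q, hq, h⟩ := h1
  exact ⟨q, hq, fun P hP hd => h2 P (h P hP hd)⟩

lemma Ev_orbit {α : Type*} (f : α → α) (z : α) (s : Set α) (hs : s.Finite) (h : ∀ n, f^[n] z ∈ s) :
    Ev (fun P => f^[P] (f^[P] z) = f^[P] z) := by
  obtain ⟨a, -, hf⟩ := pigeon (fun n => f^[n] z) s hs 0 (fun m _ => h m)
  obtain ⟨i, -, hi⟩ := hf 0
  obtain ⟨j, hj, hj'⟩ := hf (i + 1)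
  obtain ⟨p, rfl⟩ : ∃ p, j = i + p := ⟨j - i, by omega⟩
  have hp : 0 < p := by omega
  have e : ∀ n, f^[i + n + p] z = f^[i + n] z := by
    intro n
    rw [show i + n + p = n + (i + p) by ring, Function.iterate_add_apply, hj', ← hi,
      ← Function.iterate_add_apply, add_comm]
  have e2 : ∀ k n, f^[i + n + p * k] z = f^[i + n] z := by
    intro k
    induction k with
    | zero => intro n; simp
    | succ k ih =>
      intro n
      rw [show i + n + p * (k + 1) = i + (n + p * k) + p by ring, e, ← add_assoc, ih]
  refine ⟨p * (i + 1), Nat.mul_pos hp (by omega), fun P hP hd => ?_⟩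
  obtain ⟨m, hm⟩ := hd
  have hm0 : 0 < m := by
    rcases Nat.eq_zero_or_pos m with h0 | h0
    · subst h0; omega
    · exact h0
  have hPi : i ≤ P := by
    have : i + 1 ≤ p * (i + 1) * m := by
      calc i + 1 = 1 * (i + 1) * 1 := by ring
        _ ≤ p * (i + 1) * m := by gcongr <;> omega
    omega
  have := e2 ((i + 1) * m) (P - i)
  rw [← mul_assoc, ← hm, show i + (P - i) = P by omega, Function.iterate_add_apply] at this
  exact this

section Base

variable {D : Type*} {σ : D → List D} {B : Set D}

lemma Fit_B (hB : ∀ b ∈ B, ∀ c ∈ σ b, c ∈ B) (n : ℕ) {w : List D} (h : ∀ c ∈ w, c ∈ B) :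
    ∀ c ∈ (F σ)^[n] w, c ∈ B := by
  induction n with
  | zero => exact h
  | succ n ih =>
    rw [Function.iterate_succ_apply']
    intro c hc
    obtain ⟨a, ha, hca⟩ := mem_F.1 hc
    exact hB a (ih a ha) c hca

lemma Fit_G (hG : ∀ g, g ∉ B → ∃ c ∈ σ g, c ∉ B) (n : ℕ) {w : List D} (h : ∃ c ∈ w, c ∉ B) :
    ∃ c ∈ (F σ)^[n] w, c ∉ B := by
  induction n with
  | zero => exact h
  | succ n ih =>
    rw [Function.iterate_succ_apply']
    obtain ⟨a, ha, haB⟩ := ih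
    obtain ⟨c, hc, hcB⟩ := hG a haB
    exact ⟨c, mem_F.2 ⟨a, ha, hc⟩, hcB⟩

lemma Ev_hL [Finite D] (hB : ∀ b ∈ B, ∀ c ∈ σ b, c ∈ B) (hG : ∀ g, g ∉ B → ∃ c ∈ σ g, c ∉ B) :
    Ev (fun P => ∀ a g s t, (F σ)^[P] [a] = s ++ g :: t → g ∉ B → (∀ c ∈ t, c ∈ B) →
      ∃ s' t', (F σ)^[P] [g] = s' ++ g :: t' ∧ ∀ c ∈ t', c ∈ B) := by
  rcases isEmpty_or_nonempty D with hD | hD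
  · exact ⟨1, one_pos, fun P _ _ a => (hD.false a).elim⟩
  choose! q lam β h1 h2 h3 using fun g (hg : g ∉ B) => last_split (hG g hg)
  have key : ∀ n, ∀ g, g ∉ B → lam^[n] g ∉ B ∧ ∃ p t, (F σ)^[n] [g] = p ++ lam^[n] g :: t ∧
      ∀ c ∈ t, c ∈ B := by
    intro n
    induction n with
    | zero => intro g hg; exact ⟨hg, [], [], rfl, by simp⟩
    | succ n ih =>
      intro g hg
      obtain ⟨k1, p, t, k2, k3⟩ := ih g hg
      rw [Function.iterate_succ_apply', Function.iterate_succ_apply', k2]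
      refine ⟨h2 _ k1, F σ p ++ q (lam^[n] g), β (lam^[n] g) ++ F σ t, ?_, ?_⟩
      · rw [F_append, F_cons, h1 _ k1]; simp
      · intro c hc
        rcases List.mem_append.1 hc with hc | hc
        · exact h3 _ k1 c hc
        · obtain ⟨b, hb, hcb⟩ := mem_F.1 hc
          exact hB b (k3 b hb) c hcb
  refine (Ev.all (fun a : D => Ev_orbit lam a Set.univ Set.finite_univ (by simp))).mono ?_
  intro P hP a g s t h hg ht
  have ha : a ∉ B := by
    intro ha
    refine hg (Fit_B hB P (w := [a]) (by simpa using ha) g ?_)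
    rw [h]; simp
  obtain ⟨k1, p, t', k2, k3⟩ := key P a ha
  obtain ⟨-, e, -⟩ := last_unique hg k1 ht k3 (h.symm.trans k2)
  obtain ⟨-, p2, t2, k4, k5⟩ := key P g hg
  have e2 : lam^[P] g = g := by rw [e]; exact hP a
  rw [e2] at k4
  exact ⟨p2, t2, k4, k5⟩

lemma Ev_hR [Finite D] (hB : ∀ b ∈ B, ∀ c ∈ σ b, c ∈ B) (hG : ∀ g, g ∉ B → ∃ c ∈ σ g, c ∉ B) :
    Ev (fun P => ∀ a g s t, (F σ)^[P] [a] = t ++ g :: s → g ∉ B → (∀ c ∈ t, c ∈ B) →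
      ∃ s' t', (F σ)^[P] [g] = t' ++ g :: s' ∧ ∀ c ∈ t', c ∈ B) := by
  have := Ev_hL (σ := Setting.srev σ) (B := B)
    (fun b hb c hc => hB b hb c (by simpa [Setting.srev] using hc))
    (fun g hg => by simpa [Setting.srev] using hG g hg)
  refine this.mono ?_
  intro P hP a g s t h hg ht
  have e : ∀ a : D, (F (Setting.srev σ))^[P] [a] = ((F σ)^[P] [a]).reverse :=
    fun a => Setting.Fit_srev σ P [a]
  obtain ⟨s', t', k1, k2⟩ := hP a g s.reverse t.reverse (by rw [e, h]; simp) hg (by simpa using ht)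
  rw [e] at k1
  exact ⟨s'.reverse, t'.reverse, by rw [Setting.eq_rev k1]; simp, by simpa using k2⟩

lemma len_mono (hne : ∀ a, σ a ≠ []) (w : List D) {m n : ℕ} (h : m ≤ n) :
    ((F σ)^[m] w).length ≤ ((F σ)^[n] w).length := by
  induction n, h using Nat.le_induction with
  | base => exact le_rfl
  | succ n h ih =>
    rw [Function.iterate_succ_apply']
    exact ih.trans (length_le_F hne _)

lemma exists_setting [Finite D] (σ : D → List D) (hne : ∀ a, σ a ≠ []) (star : D)
    (hstar : σ star = [star]) (hns : ∀ a, a ≠ star → star ∉ σ a) :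
    ∃ (T : Setting D) (P : ℕ), 0 < P ∧ (∀ w, F T.σ w = (F σ)^[P] w) ∧ T.star = star ∧
      ∀ r, r < P → ∀ a, (F σ)^[r] [a] ∈ T.S := by
  classical
  set B : Set D := {b | (∃ K, ∀ n, ((F σ)^[n] [b]).length ≤ K) ∧ b ≠ star} with hBdef
  have hB : ∀ b ∈ B, ∀ c ∈ σ b, c ∈ B := by
    rintro b ⟨⟨K, hK⟩, hb⟩ c hc
    refine ⟨⟨K, fun n => ?_⟩, fun h => hns b hb (h ▸ hc)⟩
    have h1 := hK (n + 1)
    rw [Function.iterate_succ_apply, F_cons, F_nil, List.append_nil] at h1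
    obtain ⟨p, q, hpq⟩ := List.append_of_mem hc
    have h2 : [c] <:+: σ b := ⟨p, q, by rw [hpq]; simp⟩
    exact (Fit_infix σ n h2).length_le.trans h1
  have hG : ∀ g, g ∉ B → ∃ c ∈ σ g, c ∉ B := by
    intro g hg
    by_contra hc
    push Not at hc
    by_cases hgs : g = star
    · have := hc star (by rw [hgs, hstar]; simp)
      exact this.2 rfl
    apply hg
    refine ⟨?_, hgs⟩
    choose! K hK using fun b (hb : b ∈ B) => hb.1
    obtain ⟨K0, hK0⟩ := (Set.finite_range K).bddAbove
    refine ⟨1 + K0 * (σ g).length, fun n => ?_⟩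
    cases n with
    | zero => simp
    | succ n =>
      rw [Function.iterate_succ_apply, F_cons, F_nil, List.append_nil]
      have : ∀ w : List D, (∀ c ∈ w, c ∈ B) → ((F σ)^[n] w).length ≤ K0 * w.length := by
        intro w
        induction w with
        | nil => intro _; simp [Fit_nil]
        | cons a w ih =>
          intro hw
          have h1 := ih (fun c hc => hw c (by simp [hc]))
          have h2 := hK a (hw a (by simp)) n
          have h3 := hK0 ⟨a, rfl⟩
          rw [show a :: w = [a] ++ w from rfl, Fit_append, List.length_append, List.length_append,
            Nat.mul_add]
          simp only [List.length_singleton, mul_one]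
          omega
      have := this _ hc
      omega
  have hidem : Ev (fun P => ∀ b : D, b ∈ B → (F σ)^[P] ((F σ)^[P] [b]) = (F σ)^[P] [b]) := by
    apply Ev.all
    intro b
    by_cases hb : b ∈ B
    · obtain ⟨⟨K, hK⟩, -⟩ := id hb
      exact (Ev_orbit (F σ) [b] _ (List.finite_length_le D K) hK).mono (fun P h _ => h)
    · exact ⟨1, one_pos, fun P _ _ h => (hb h).elim⟩
  obtain ⟨P, hP, hall⟩ := hidem.and ((Ev_hL hB hG).and (Ev_hR hB hG))
  obtain ⟨h1, h2, h3⟩ := hall P hP dvd_rfl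
  have hF : ∀ w, F (fun a => (F σ)^[P] [a]) w = (F σ)^[P] w := fun w => (Fit_eq σ P w).symm
  have hFf : F (fun a => (F σ)^[P] [a]) = (F σ)^[P] := funext hF
  have hstarn : ∀ n, (F σ)^[n] [star] = [star] := by
    intro n
    induction n with
    | zero => rfl
    | succ n ih => rw [Function.iterate_succ_apply', ih]; simp [hstar]
  refine ⟨{ σ := fun a => (F σ)^[P] [a]
            S := {w | ∃ r, r < P ∧ ∃ a, (F σ)^[r] [a] = w}
            B := B
            star := star
            finS := ?_
            ne := ?_
            starB := fun h => h.2 rfl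
            hstar := hstarn P
            hB := fun b hb => Fit_B hB P (w := [b]) (by simpa using hb)
            hG := fun g hg => Fit_G hG P (w := [g]) (by simpa using hg)
            idem := fun b hb => by rw [hF]; exact h1 b hb
            hL := h2
            hR := h3
            grow := ?_ }, P, hP, hF, rfl, fun r hr a => ⟨r, hr, a, rfl⟩⟩
  · refine ((Set.finite_Iio P).prod (Set.finite_univ (α := D))).image
      (fun t => (F σ)^[t.1] [t.2]) |>.subset ?_
    rintro w ⟨r, hr, a, rfl⟩
    exact ⟨(r, a), ⟨hr, trivial⟩, rfl⟩
  · intro a h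
    have := len_mono hne [a] (Nat.zero_le P)
    rw [h] at this
    simp at this
  · intro K
    have : ∀ g : D, ∃ n0, g ∉ B → g ≠ star → K ≤ ((F σ)^[n0] [g]).length := by
      intro g
      by_cases hg : g ∉ B ∧ g ≠ star
      · by_contra hc
        push Not at hc
        apply hg.1
        exact ⟨⟨K, fun n => (hc n).2.2.le⟩, hg.2⟩
      · exact ⟨0, fun ha hb => (hg ⟨ha, hb⟩).elim⟩
    choose n0 hn0 using this
    obtain ⟨N, hN⟩ := (Set.finite_range n0).bddAbove
    refine ⟨N, fun n hn g hg hgs => (hn0 g hg hgs).trans ?_⟩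
    rw [hFf, ← Function.iterate_mul]
    apply len_mono hne
    have h4 := hN ⟨g, rfl⟩
    calc n0 g ≤ n := h4.trans hn
      _ ≤ P * n := Nat.le_mul_of_pos_left _ hP

end Base

/-- extended substitution -/
def ext (σ : A → List A) : Option A → List (Option A)
  | none => [none]
  | some a => (σ a).map some

lemma F_ext (σ : A → List A) (w : List A) : F (ext σ) (w.map some) = (F σ w).map some := by
  induction w with
  | nil => rfl
  | cons a w ih => simp [ih, ext]

lemma Fit_ext (σ : A → List A) (n : ℕ) (w : List A) :
    (F (ext σ))^[n] (w.map some) = ((F σ)^[n] w).map some := by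
  induction n generalizing w with
  | zero => rfl
  | succ n ih => rw [Function.iterate_succ_apply, Function.iterate_succ_apply, F_ext, ih]

lemma factor_some (x : ℤ → A) (i : ℤ) (m : ℕ) :
    factor (fun n => some (x n)) i m = (factor x i m).map some := by
  simp [factor_eq]

lemma lang_some (x : ℤ → A) : lang (fun n => some (x n)) = List.map some '' lang x := by
  ext w
  constructor
  · rintro ⟨i, m, rfl⟩
    exact ⟨_, ⟨i, m, rfl⟩, (factor_some x i m).symm⟩
  · rintro ⟨_, ⟨i, m, rfl⟩, rfl⟩
    exact ⟨i, m, (factor_some x i m).symm⟩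

theorem final [Finite A] (σ : A → List A) (hσ : NonErasing σ) :
    {U : Set (List A) | ∃ x ∈ subX σ, U = lang x}.Finite := by
  obtain ⟨T, P, hP, hF, hs, hS⟩ := exists_setting (ext σ) (by
      rintro (_ | a) h
      · simp [ext] at h
      · exact hσ a (by simpa [ext] using h)) none rfl (by
      rintro (_ | a) h
      · exact absurd rfl h
      · simp [ext])
  have hFf : F T.σ = (F (ext σ))^[P] := funext hF
  have hinj : Function.Injective (fun U : Set (List A) => List.map some '' U) :=
    Set.image_injective.2 (List.map_injective_iff.2 (Option.some_injective A))
  refine ((Setting.main T).preimage hinj.injOn).subset ?_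
  rintro U ⟨x, hx, rfl⟩
  refine ⟨fun n => some (x n), ⟨fun i m => ?_, fun i => by rw [hs]; simp⟩, (lang_some x).symm⟩
  obtain ⟨n, a, h⟩ := hx _ ⟨i, m, rfl⟩
  rw [iter_eq] at h
  rw [factor_some]
  have h1 := h.map some
  rw [← Fit_ext] at h1
  refine ⟨n / P, _, hS (n % P) (Nat.mod_lt _ hP) (some a), h1.trans ?_⟩
  have e : (F (ext σ))^[n] (List.map some [a]) = (F T.σ)^[n / P] ((F (ext σ))^[n % P] [some a]) := by
    rw [hFf, ← Function.iterate_mul, ← Function.iterate_add_apply, Nat.div_add_mod]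
    rfl
  rw [e]
  apply Fit_infix
  exact ⟨[T.star], [T.star], by simp⟩

end RecogAux

open Recog in
/-- For a substitution `σ`, the set of languages of points of `X_σ` is finite. -/
theorem stmt9 {A : Type*} [Fintype A] (σ : A → List A) (hσ : NonErasing σ) :
    {ℒ : Set (List A) | ∃ x ∈ subX σ, ℒ = lang x}.Finite := by
  exact RecogAux.final σ hσ
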